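/- Let n ≥ 2 be an integer, p a prime, and 0 < κ < 1. Then there exist constants C₀, C₁, C₂ > 0 depending only on n, p, κ such that for every real θ with 0 ≤ θ ≤ (n+1)/3 and every ball B ⊆ ℤ_p, one has, for all sufficiently large Q, #(𝔸_n(Q, θ, C₀, C₁, C₂) ∩ B) ≥ (κ/(p C₀)) · Q^{n+1−2θ} μ(B), where 𝔸_n(Q, θ, C₀, C₁, C₂) is the set of α ∈ ℤ_p for which there exists an irreducible polynomial P ∈ ℤ[X] of degree n with P(α) = 0 and C₁ Q ≤ H(P) ≤ C₂ Q, such that P has a root β in the algebraic closure of ℚ_p with 0 < |α − β|_p ≤ C₀ Q^{−θ}. -/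

import Mathlib

open Polynomial MeasureTheory

noncomputable instance (p : ℕ) [Fact p.Prime] : MeasurableSpace ℚ_[p] := borel _
instance (p : ℕ) [Fact p.Prime] : BorelSpace ℚ_[p] := ⟨rfl⟩

/-- The height of an integer polynomial: the maximum of the absolute values of its
coefficients. -/
def polyHeight (P : Polynomial ℤ) : ℕ :=
  (Finset.range (P.natDegree + 1)).sup fun i => (P.coeff i).natAbs

/-- `x` is protected by a flag: some chain `G ⊆ S` on which `ψ · x ≤ ρ`, such that every element
of `S` comparable with all of `G` has `ψ`-value exceeding `σ` at `x`. -/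
def HasFlag {X ι : Type*} [PartialOrder ι] (ψ : ι → X → ℝ) (S : Set ι) (ρ σ : ℝ) (x : X) : Prop :=
  ∃ G : Set ι, G ⊆ S ∧ IsChain (· ≤ ·) G ∧ (∀ V ∈ G, ψ V x ≤ ρ) ∧
    ∀ W ∈ S, (∀ V ∈ G, W ≤ V ∨ V ≤ W) → σ < ψ W x

theorem HasFlag.of_comparable {X ι : Type*} [PartialOrder ι] {ψ : ι → X → ℝ} {S : Set ι}
    {ρ σ : ℝ} {x : X} {V : ι} (hV : V ∈ S) (h1 : ψ V x ≤ ρ) (h2 : σ < ψ V x)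
    (h : HasFlag ψ {W ∈ S | W ≠ V ∧ (W ≤ V ∨ V ≤ W)} ρ σ x) : HasFlag ψ S ρ σ x := by
  obtain ⟨G, hGS, hG, hle, hlt⟩ := h
  refine ⟨insert V G, ?_, ?_, ?_, ?_⟩
  · exact Set.insert_subset hV fun W hW => (hGS hW).1
  · refine hG.insert fun W hW _ => ?_
    exact ((hGS hW).2.2).symm
  · rintro W (rfl | hW)
    · exact h1
    · exact hle W hW
  · intro W hW hcomp
    by_cases hWV : W = V
    · rw [hWV]; exact h2
    · exact hlt W ⟨hW, hWV, hcomp V (Set.mem_insert _ _)⟩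
        fun U hU => hcomp U (Set.mem_insert_of_mem _ hU)

open Classical in
theorem card_not_hasFlag_le {X ι : Type*} [PartialOrder ι]
    (ball : X → ℕ → Finset X) (N q : ℕ) (hq : 1 ≤ q)
    (hmem : ∀ x j, x ∈ ball x j) (heq : ∀ x y j, y ∈ ball x j → ball y j = ball x j)
    (hanti : ∀ x i j, i ≤ j → ball x j ⊆ ball x i)
    (hcard : ∀ x j, (ball x j).card ≤ q * (ball x (j + 1)).card)
    (hN : ∀ x, ball x N = {x})
    (ψ : ι → X → ℝ) (ρ σ η : ℝ) (hσρ : σ ≤ ρ) (hη : 0 ≤ η)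
    (hgood : ∀ V x j, (∃ y ∈ ball x j, ρ < ψ V y) →
      (((ball x j).filter fun z => ψ V z ≤ σ).card : ℝ) ≤ η * (ball x j).card)
    (k : ℕ) : ∀ S : Set ι,
      (∀ C : Finset ι, (C : Set ι) ⊆ S → IsChain (· ≤ ·) (C : Set ι) → C.card ≤ k) →
      ∀ x j, j ≤ N → (∀ W ∈ S, ∃ y ∈ ball x j, ρ < ψ W y) →
      (((ball x j).filter fun z => ¬ HasFlag ψ S ρ σ z).card : ℝ) ≤
        k * q ^ k * η * (ball x j).card := by
  induction k with
  | zero =>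
    intro S hS x j _ _
    have hSe : S = ∅ := by
      rw [Set.eq_empty_iff_forall_notMem]
      intro V hV
      have := hS {V} (by simpa using hV) (by simp)
      simp at this
    have : (ball x j).filter (fun z => ¬ HasFlag ψ S ρ σ z) = ∅ := by
      rw [Finset.filter_eq_empty_iff]
      intro z _
      rw [not_not, hSe]
      exact ⟨∅, by simp, by simp, by simp, by simp⟩
    simp [this]
  | succ k ih =>
    intro S hS x₀ j₀ hj₀ htop
    set bad := (ball x₀ j₀).filter fun z => ¬ HasFlag ψ S ρ σ z with hbad
    have hex : ∀ x ∈ bad, ∃ j, ∃ V ∈ S, ∀ y ∈ ball x j, ψ V y ≤ ρ := by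
      intro x hx
      by_contra! hcon
      rw [hbad, Finset.mem_filter] at hx
      refine hx.2 ⟨∅, by simp, by simp, by simp, ?_⟩
      intro W hW _
      obtain ⟨y, hy, hlt⟩ := hcon N W hW
      rw [hN, Finset.mem_singleton] at hy
      rw [← hy]; exact hσρ.trans_lt hlt
    let lev : X → ℕ := fun x =>
      if h : ∃ j, ∃ V ∈ S, ∀ y ∈ ball x j, ψ V y ≤ ρ then Nat.find h else 0
    have hlev : ∀ x ∈ bad, (∃ V ∈ S, ∀ y ∈ ball x (lev x), ψ V y ≤ ρ) ∧
        ∀ i < lev x, ∀ V ∈ S, ∃ y ∈ ball x i, ρ < ψ V y := by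
      intro x hx
      have h := hex x hx
      have e : lev x = Nat.find h := dif_pos h
      rw [e]
      refine ⟨Nat.find_spec h, fun i hi V hV => ?_⟩
      have := Nat.find_min h hi
      push Not at this
      exact this V hV
    have hlt : ∀ x ∈ bad, j₀ < lev x := by
      intro x hx
      by_contra! hle
      obtain ⟨V, hV, hsm⟩ := (hlev x hx).1
      obtain ⟨y, hy, hy'⟩ := htop V hV
      have hx0 : x ∈ ball x₀ j₀ := (Finset.mem_filter.1 hx).1
      rw [← heq _ _ _ hx0] at hy
      exact absurd (hsm y (hanti _ _ _ hle hy)) (not_le.2 hy')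
    have hlevN : ∀ x ∈ bad, lev x ≤ N := by
      intro x hx
      by_contra! hle
      obtain ⟨hx0, hx1⟩ := Finset.mem_filter.1 hx
      refine hx1 ⟨∅, by simp, by simp, by simp, ?_⟩
      intro W hW _
      obtain ⟨y, hy, hlt⟩ := (hlev x hx).2 N hle W hW
      rw [hN, Finset.mem_singleton] at hy
      rw [← hy]; exact hσρ.trans_lt hlt
    have hlevb : ∀ x ∈ bad, ∀ y ∈ bad, y ∈ ball x (lev x) → lev y = lev x := by
      intro x hx y hy hyx
      have hb := heq _ _ _ hyx
      have hle : lev y ≤ lev x := by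
        by_contra! hcon
        obtain ⟨V, hV, hsm⟩ := (hlev x hx).1
        obtain ⟨w, hw, hw'⟩ := (hlev y hy).2 _ hcon V hV
        rw [hb] at hw
        exact absurd (hsm w hw) (not_le.2 hw')
      refine le_antisymm hle ?_
      by_contra! hcon
      obtain ⟨V, hV, hsm⟩ := (hlev y hy).1
      obtain ⟨w, hw, hw'⟩ := (hlev x hx).2 _ hcon V hV
      have hyx' : y ∈ ball x (lev y) := hanti _ _ _ hle hyx
      rw [← heq _ _ _ hyx'] at hw
      exact absurd (hsm w hw) (not_le.2 hw')
    let F : X → Finset X := fun x => ball x (lev x)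
    have hbound : ∀ x ∈ bad, ((bad.filter fun z => F z = F x).card : ℝ) ≤
        ((k + 1 : ℕ) * q ^ (k + 1) * η) * (F x).card := by
      intro x hx
      obtain ⟨V, hV, hsm⟩ := (hlev x hx).1
      have hpos : 0 < lev x := (Nat.zero_le _).trans_lt (hlt x hx)
      obtain ⟨i, hi⟩ : ∃ i, lev x = i + 1 := ⟨lev x - 1, by omega⟩
      have hbig := (hlev x hx).2 i (by omega)
      set S' := {W ∈ S | W ≠ V ∧ (W ≤ V ∨ V ≤ W)} with hS'
      have hchain : ∀ C : Finset ι, (C : Set ι) ⊆ S' → IsChain (· ≤ ·) (C : Set ι) →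
          C.card ≤ k := by
        intro C hCS hC
        have hVC : V ∉ C := fun h => (hCS h).2.1 rfl
        have := hS (insert V C) ?_ ?_
        · rw [Finset.card_insert_of_notMem hVC] at this; omega
        · rw [Finset.coe_insert]
          exact Set.insert_subset hV fun W hW => (hCS hW).1
        · rw [Finset.coe_insert]
          exact hC.insert fun W hW _ => ((hCS hW).2.2).symm
      have h1 := ih S' hchain x i (by have := hlevN x hx; omega) fun W hW => hbig W hW.1
      have h2 := hgood V x i (hbig V hV)
      have hsub : (bad.filter fun z => F z = F x) ⊆
          ((ball x i).filter fun z => ¬ HasFlag ψ S' ρ σ z) ∪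
            ((ball x i).filter fun z => ψ V z ≤ σ) := by
        intro z hz
        obtain ⟨hzb, hzF⟩ := Finset.mem_filter.1 hz
        have hzx : z ∈ ball x (lev x) := by
          have : z ∈ F z := hmem _ _
          rw [hzF] at this; exact this
        have hzi : z ∈ ball x i := hanti _ _ _ (by omega) hzx
        rw [Finset.mem_union, Finset.mem_filter, Finset.mem_filter]
        by_cases hz2 : ψ V z ≤ σ
        · exact Or.inr ⟨hzi, hz2⟩
        · refine Or.inl ⟨hzi, fun hfl => (Finset.mem_filter.1 hzb).2 ?_⟩
          exact HasFlag.of_comparable hV (hsm z hzx) (not_le.1 hz2) hfl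
      have hc1 : ((bad.filter fun z => F z = F x).card : ℝ) ≤
          k * q ^ k * η * (ball x i).card + η * (ball x i).card := by
        refine le_trans ?_ (add_le_add h1 h2)
        exact_mod_cast (Finset.card_le_card hsub).trans (Finset.card_union_le _ _)
      have hc2 : ((ball x i).card : ℝ) ≤ q * (F x).card := by
        have := hcard x i
        rw [← hi] at this
        exact_mod_cast this
      have hq1 : (1 : ℝ) ≤ q ^ k := one_le_pow₀ (by exact_mod_cast hq)
      calc ((bad.filter fun z => F z = F x).card : ℝ)
          ≤ (k * q ^ k + 1) * η * (ball x i).card := by linarith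
        _ ≤ (k * q ^ k + q ^ k) * η * (q * (F x).card) := by gcongr
        _ = _ := by push_cast; ring
    calc (bad.card : ℝ) = ∑ D ∈ bad.image F, ((bad.filter fun z => F z = D).card : ℝ) := by
          rw [Finset.card_eq_sum_card_image F bad]; push_cast; rfl
      _ ≤ ∑ D ∈ bad.image F, ((k + 1 : ℕ) * q ^ (k + 1) * η) * (D.card : ℝ) := by
          refine Finset.sum_le_sum fun D hD => ?_
          obtain ⟨x, hx, rfl⟩ := Finset.mem_image.1 hD
          exact hbound x hx
      _ = ((k + 1 : ℕ) * q ^ (k + 1) * η) * (((bad.image F).biUnion id).card : ℝ) := by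
          rw [← Finset.mul_sum, Finset.card_biUnion]
          · push_cast; rfl
          · intro D hD D' hD' hne
            obtain ⟨x, hx, rfl⟩ := Finset.mem_image.1 hD
            obtain ⟨y, hy, rfl⟩ := Finset.mem_image.1 hD'
            rw [Function.onFun, Finset.disjoint_left]
            intro z hzx hzy
            apply hne
            simp only [id, F] at hzx hzy ⊢
            rcases le_total (lev x) (lev y) with h | h
            · have hyx : y ∈ ball x (lev x) := by
                have := hanti _ _ _ h hzy
                rw [← heq _ _ _ hzx, heq _ _ _ this]
                exact hmem _ _
              rw [hlevb x hx y hy hyx, heq _ _ _ hyx]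
            · have hxy : x ∈ ball y (lev y) := by
                have := hanti _ _ _ h hzx
                rw [← heq _ _ _ hzy, heq _ _ _ this]
                exact hmem _ _
              rw [hlevb y hy x hx hxy, heq _ _ _ hxy]
      _ ≤ ((k + 1 : ℕ) * q ^ (k + 1) * η) * ((ball x₀ j₀).card : ℝ) := by
          have : (bad.image F).biUnion id ⊆ ball x₀ j₀ := by
            rw [Finset.biUnion_subset]
            intro D hD
            obtain ⟨x, hx, rfl⟩ := Finset.mem_image.1 hD
            have hx0 : x ∈ ball x₀ j₀ := (Finset.mem_filter.1 hx).1
            rw [← heq _ _ _ hx0]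
            exact hanti _ _ _ (hlt x hx).le
          gcongr

/-- The residue ball of level `j` around `x` inside `{0, …, p ^ N - 1}`. -/
def resBall (p N : ℕ) (x : Fin (p ^ N)) (j : ℕ) : Finset (Fin (p ^ N)) :=
  Finset.univ.filter fun y => (y : ℕ) ≡ x [MOD p ^ j]

section ResBall

variable {p N : ℕ}

theorem mem_resBall {x y : Fin (p ^ N)} {j : ℕ} :
    y ∈ resBall p N x j ↔ (y : ℕ) ≡ x [MOD p ^ j] := by
  simp [resBall]

theorem mem_resBall_self (x : Fin (p ^ N)) (j : ℕ) : x ∈ resBall p N x j :=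
  mem_resBall.2 rfl

theorem resBall_eq_of_mem (x y : Fin (p ^ N)) (j : ℕ) (h : y ∈ resBall p N x j) :
    resBall p N y j = resBall p N x j := by
  ext z
  rw [mem_resBall] at *
  rw [mem_resBall]
  exact ⟨fun h' => h'.trans h, fun h' => h'.trans h.symm⟩

theorem resBall_anti (x : Fin (p ^ N)) (i j : ℕ) (hij : i ≤ j) :
    resBall p N x j ⊆ resBall p N x i := by
  intro z hz
  rw [mem_resBall] at *
  exact hz.of_dvd (pow_dvd_pow p hij)

theorem resBall_eq_singleton (x : Fin (p ^ N)) (j : ℕ) (hp : 0 < p) (hj : N ≤ j) :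
    resBall p N x j = {x} := by
  ext z
  rw [mem_resBall, Finset.mem_singleton]
  constructor
  · intro h
    have hle : p ^ N ≤ p ^ j := Nat.pow_le_pow_right hp hj
    exact Fin.ext (h.eq_of_lt_of_lt (z.2.trans_le hle) (x.2.trans_le hle))
  · rintro rfl; rfl

theorem card_resBall (x : Fin (p ^ N)) (j : ℕ) (hp : 0 < p) (hj : j ≤ N) :
    (resBall p N x j).card = p ^ (N - j) := by
  have hpj : 0 < p ^ j := Nat.pow_pos hp
  have h1 : (resBall p N x j).card =
      Nat.count (fun y => y ≡ (x : ℕ) [MOD p ^ j]) (p ^ N) := by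
    rw [Nat.count_eq_card_filter_range, ← Finset.card_map Fin.valEmbedding]
    congr 1
    ext z
    simp only [Finset.mem_map, mem_resBall, Fin.valEmbedding_apply, Finset.mem_filter,
      Finset.mem_range]
    constructor
    · rintro ⟨y, hy, rfl⟩
      exact ⟨y.2, hy⟩
    · rintro ⟨hz, h⟩
      exact ⟨⟨z, hz⟩, h, rfl⟩
  rw [h1, Nat.count_modEq_card _ hpj]
  have hdvd : p ^ j ∣ p ^ N := pow_dvd_pow p hj
  rw [Nat.mod_eq_zero_of_dvd hdvd, Nat.pow_div hj hp]
  simp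

theorem card_resBall_le_mul (x : Fin (p ^ N)) (j : ℕ) (hp : 0 < p) :
    (resBall p N x j).card ≤ p * (resBall p N x (j + 1)).card := by
  rcases lt_or_ge j N with h | h
  · rw [card_resBall x j hp h.le, card_resBall x (j + 1) hp h, ← pow_succ']
    apply le_of_eq
    congr 1
    omega
  · rw [resBall_eq_singleton x j hp h, resBall_eq_singleton x (j + 1) hp (by omega)]
    rw [Finset.card_singleton, mul_one]
    exact hp

end ResBall

section PadicPolynomial

variable {p : ℕ} [hp : Fact p.Prime]

theorem norm_natCast_sub_le {x y j : ℕ} (h : x ≡ y [MOD p ^ j]) :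
    ‖(x : ℚ_[p]) - y‖ ≤ (p : ℝ) ^ (-(j : ℤ)) := by
  have h1 := (Nat.modEq_iff_dvd.1 h.symm)
  have h2 := (Padic.norm_int_le_pow_iff_dvd (p := p) ((x : ℤ) - y) j).2 (by exact_mod_cast h1)
  exact_mod_cast h2

theorem modEq_of_norm_sub_le {x y j : ℕ} (h : ‖(x : ℚ_[p]) - y‖ ≤ (p : ℝ) ^ (-(j : ℤ))) :
    x ≡ y [MOD p ^ j] := by
  have h2 := (Padic.norm_int_le_pow_iff_dvd (p := p) ((x : ℤ) - y) j).1 (by exact_mod_cast h)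
  exact (Nat.modEq_iff_dvd.2 (by exact_mod_cast h2)).symm

theorem norm_eval_le_of_interpolation (f : ℚ_[p][X]) {d : ℕ} (hd : f.natDegree ≤ d)
    (t : Finset ℕ) (ht : t.card = d + 1) (y j l : ℕ) (hy : ∀ z ∈ t, z ≡ y [MOD p ^ j])
    (hsep : ∀ z ∈ t, ∀ w ∈ t, z ≠ w → ¬ z ≡ w [MOD p ^ (j + l)]) {c : ℝ} (hc0 : 0 ≤ c)
    (hc : ∀ z ∈ t, ‖f.eval (z : ℚ_[p])‖ ≤ c) :
    ‖f.eval (y : ℚ_[p])‖ ≤ (p : ℝ) ^ (l * d) * c := by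
  classical
  have hp0 : (0 : ℝ) < p := by exact_mod_cast hp.out.pos
  have hinj : Set.InjOn (fun z : ℕ => (z : ℚ_[p])) (t : Set ℕ) :=
    fun a _ b _ hab => Nat.cast_injective hab
  have hdeg : f.degree < t.card := by
    refine lt_of_le_of_lt Polynomial.degree_le_natDegree ?_
    rw [ht]; exact_mod_cast Nat.lt_succ_of_le hd
  rw [Lagrange.eq_interpolate hinj hdeg, Lagrange.interpolate_apply, eval_finsetSum]
  refine IsUltrametricDist.norm_sum_le_of_forall_le_of_nonneg (by positivity) fun z hz => ?_
  rw [eval_mul, eval_C, norm_mul, mul_comm]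
  refine mul_le_mul ?_ (hc z hz) (norm_nonneg _) (by positivity)
  rw [Lagrange.basis, eval_prod, norm_prod]
  have hcard : (t.erase z).card = d := by rw [Finset.card_erase_of_mem hz, ht]; rfl
  have : (p : ℝ) ^ (l * d) = ∏ w ∈ t.erase z, (p : ℝ) ^ l := by
    rw [Finset.prod_const, hcard, pow_mul]
  rw [this]
  refine Finset.prod_le_prod (fun _ _ => norm_nonneg _) fun w hw => ?_
  have hw' := Finset.mem_of_mem_erase hw
  have hne : z ≠ w := (Finset.ne_of_mem_erase hw).symm
  rw [Lagrange.basisDivisor, eval_mul, eval_C, eval_sub, eval_X, eval_C, norm_mul, norm_inv]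
  have h1 : ‖(y : ℚ_[p]) - w‖ ≤ (p : ℝ) ^ (-(j : ℤ)) := norm_natCast_sub_le (hy w hw').symm
  have h2 : (p : ℝ) ^ (-((j + l : ℕ) : ℤ)) ≤ ‖(z : ℚ_[p]) - w‖ := by
    by_contra! hlt
    exact hsep z hz w hw' hne (modEq_of_norm_sub_le hlt.le)
  have hpos : (0 : ℝ) < (p : ℝ) ^ (-((j + l : ℕ) : ℤ)) := by positivity
  rw [inv_mul_le_iff₀ (hpos.trans_le h2)]
  refine h1.trans (le_trans (le_of_eq ?_) (mul_le_mul_of_nonneg_right h2 (by positivity)))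
  rw [← zpow_natCast, ← zpow_add₀ hp0.ne']
  congr 1
  push_cast; ring

open Classical in
theorem card_filter_norm_eval_le {N : ℕ} (f : ℚ_[p][X]) {d : ℕ} (hd : f.natDegree ≤ d)
    (x y : Fin (p ^ N)) {j l : ℕ} (hjl : j + l ≤ N) (hy : y ∈ resBall p N x j) {c : ℝ}
    (hc0 : 0 ≤ c) (hc : (p : ℝ) ^ (l * d) * c < ‖f.eval ((y : ℕ) : ℚ_[p])‖) :
    ((resBall p N x j).filter fun z : Fin (p ^ N) => ‖f.eval ((z : ℕ) : ℚ_[p])‖ ≤ c).card ≤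
      p ^ (N - (j + l)) * d := by
  set s := (resBall p N x j).filter fun z : Fin (p ^ N) => ‖f.eval ((z : ℕ) : ℚ_[p])‖ ≤ c with hs
  have h1 : (s.image fun z => resBall p N z (j + l)).card ≤ d := by
    by_contra! hlt
    obtain ⟨u, hu, hucard⟩ := Finset.exists_subset_card_eq (Nat.succ_le_of_lt hlt)
    have hch : ∀ D ∈ u, ∃ z ∈ s, resBall p N z (j + l) = D := fun D hD => by
      simpa using hu hD
    choose! g hg hg' using hch
    have hginj : Set.InjOn (fun D => ((g D : Fin (p ^ N)) : ℕ)) (u : Set (Finset (Fin (p ^ N)))) := by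
      intro D hD E hE h
      have h' : g D = g E := Fin.ext h
      rw [← hg' D hD, ← hg' E hE, h']
    have := norm_eval_le_of_interpolation f hd (u.image fun D => ((g D : Fin (p ^ N)) : ℕ))
      (by rw [Finset.card_image_of_injOn hginj, hucard]) y j l ?_ ?_ hc0 ?_
    · exact absurd this (not_le.2 hc)
    · intro z hz
      obtain ⟨D, hD, rfl⟩ := Finset.mem_image.1 hz
      have h := (Finset.mem_filter.1 (hg D hD)).1
      rw [mem_resBall] at h hy
      exact h.trans hy.symm
    · intro z hz w hw hne hmod
      obtain ⟨D, hD, rfl⟩ := Finset.mem_image.1 hz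
      obtain ⟨E, hE, rfl⟩ := Finset.mem_image.1 hw
      apply hne
      have : D = E := by
        rw [← hg' D hD, ← hg' E hE]
        exact resBall_eq_of_mem _ _ _ (mem_resBall.2 hmod)
      rw [this]
    · intro z hz
      obtain ⟨D, hD, rfl⟩ := Finset.mem_image.1 hz
      exact (Finset.mem_filter.1 (hg D hD)).2
  calc s.card ≤ p ^ (N - (j + l)) * (s.image fun z => resBall p N z (j + l)).card := by
        refine Finset.card_le_mul_card_image _ _ fun D hD => ?_
        obtain ⟨w, hw, rfl⟩ := Finset.mem_image.1 hD
        rw [← card_resBall w (j + l) hp.out.pos hjl]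
        refine Finset.card_le_card fun z hz => ?_
        rw [← (Finset.mem_filter.1 hz).2]
        exact mem_resBall_self _ _
    _ ≤ p ^ (N - (j + l)) * d := Nat.mul_le_mul_left _ h1

end PadicPolynomial

section Covolume

open Module

/-- The inclusion of integer vectors into rational vectors. -/
def toRat (m : ℕ) : (Fin m → ℤ) →+ (Fin m → ℚ) := (Int.castAddHom ℚ).compLeft (Fin m)

@[simp]
theorem toRat_apply {m : ℕ} (z : Fin m → ℤ) (i : Fin m) : toRat m z i = (z i : ℚ) := rfl

theorem toRat_injective (m : ℕ) : Function.Injective (toRat m) := by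
  intro a b h
  ext i
  have := congrFun h i
  simpa using this

/-- The sup norm of an integer vector. -/
def vecHeight {m : ℕ} (z : Fin m → ℤ) : ℕ := Finset.univ.sup fun i => (z i).natAbs

theorem natAbs_le_vecHeight {m : ℕ} (z : Fin m → ℤ) (i : Fin m) : (z i).natAbs ≤ vecHeight z :=
  Finset.le_sup (f := fun i => (z i).natAbs) (Finset.mem_univ i)

/-- The largest absolute value of a maximal minor of a tuple of integer vectors. -/
def minorNorm {m k : ℕ} (z : Fin k → Fin m → ℤ) : ℕ :=
  Finset.univ.sup fun f : Fin k → Fin m => (Matrix.det (Matrix.of fun i j => z i (f j))).natAbs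

theorem natAbs_det_le_minorNorm {m k : ℕ} (z : Fin k → Fin m → ℤ) (f : Fin k → Fin m) :
    (Matrix.det (Matrix.of fun i j => z i (f j))).natAbs ≤ minorNorm z :=
  Finset.le_sup (f := fun f : Fin k → Fin m =>
    (Matrix.det (Matrix.of fun i j => z i (f j))).natAbs) (Finset.mem_univ f)

/-- The minor of `Fin.cons x u` on the columns `f`, as a linear form in `x`. -/
noncomputable def minorForm {m k : ℕ} (u : Fin k → Fin m → ℤ) (f : Fin (k + 1) → Fin m) :
    (Fin m → ℚ) →ₗ[ℚ] ℚ :=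
  ∑ j : Fin (k + 1), ((-1 : ℚ) ^ (j : ℕ) *
    ((Matrix.det (Matrix.of fun i j' => u i (f (j.succAbove j'))) : ℤ) : ℚ)) •
      (LinearMap.proj (f j) : (Fin m → ℚ) →ₗ[ℚ] ℚ)

theorem det_cons_eq {m k : ℕ} (u : Fin k → Fin m → ℤ) (f : Fin (k + 1) → Fin m) (v : Fin m → ℤ) :
    Matrix.det (Matrix.of fun i j => (Fin.cons v u : Fin (k + 1) → Fin m → ℤ) i (f j)) =
      ∑ j : Fin (k + 1), (-1) ^ (j : ℕ) * v (f j) *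
        Matrix.det (Matrix.of fun i j' => u i (f (j.succAbove j'))) := by
  rw [Matrix.det_succ_row_zero]
  rfl

theorem minorForm_toRat {m k : ℕ} (u : Fin k → Fin m → ℤ) (f : Fin (k + 1) → Fin m)
    (v : Fin m → ℤ) : minorForm u f (toRat m v) =
      ((Matrix.det (Matrix.of fun i j =>
        (Fin.cons v u : Fin (k + 1) → Fin m → ℤ) i (f j)) : ℤ) : ℚ) := by
  rw [det_cons_eq, minorForm, LinearMap.sum_apply]
  push_cast
  refine Finset.sum_congr rfl fun j _ => ?_
  simp only [LinearMap.smul_apply, LinearMap.proj_apply, toRat_apply, smul_eq_mul]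
  ring

theorem minorForm_eq_zero {m k : ℕ} (u : Fin k → Fin m → ℤ) (f : Fin (k + 1) → Fin m)
    {x : Fin m → ℚ} (hx : x ∈ Submodule.span ℚ (Set.range fun i => toRat m (u i))) :
    minorForm u f x = 0 := by
  have : Submodule.span ℚ (Set.range fun i => toRat m (u i)) ≤ LinearMap.ker (minorForm u f) := by
    rw [Submodule.span_le]
    rintro _ ⟨i, rfl⟩
    change minorForm u f (toRat m (u i)) = 0
    rw [minorForm_toRat, Matrix.det_zero_of_row_eq (i := 0) (j := i.succ) (Fin.succ_ne_zero i).symm]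
    · simp
    · ext j; simp [Matrix.of_apply]
  exact this hx

theorem exists_det_ne_zero {m k : ℕ} (z : Fin k → Fin m → ℤ)
    (hz : LinearIndependent ℚ fun i => toRat m (z i)) :
    ∃ f : Fin k → Fin m, Matrix.det (Matrix.of fun i j => z i (f j)) ≠ 0 := by
  set A : Matrix (Fin k) (Fin m) ℚ := Matrix.of fun i => toRat m (z i) with hA
  have hr : A.rank = k := by
    have := LinearIndependent.rank_matrix (M := A) hz
    simpa using this
  rw [Matrix.rank_eq_finrank_span_cols] at hr
  obtain ⟨g, hg, -, hgi⟩ := Submodule.exists_fun_fin_finrank_span_eq ℚ (Set.range A.col)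
  choose f hf using hg
  let e : Fin k ≃ Fin (finrank ℚ (Submodule.span ℚ (Set.range A.col))) := finCongr hr.symm
  refine ⟨fun i => f (e i), ?_⟩
  have h1 : LinearIndependent ℚ
      (Matrix.of fun i j => ((z i (f (e j)) : ℤ) : ℚ) : Matrix (Fin k) (Fin k) ℚ).col := by
    have h2 := hgi.comp e e.injective
    have heq : (Matrix.of fun i j => ((z i (f (e j)) : ℤ) : ℚ) : Matrix (Fin k) (Fin k) ℚ).col =
        g ∘ e := by
      ext j i
      simp only [Function.comp, ← hf]
      rfl
    rw [heq]
    exact h2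
  rw [Matrix.linearIndependent_cols_iff_isUnit, Matrix.isUnit_iff_isUnit_det, isUnit_iff_ne_zero]
    at h1
  intro h0
  apply h1
  have := Int.cast_det (R := ℚ) (Matrix.of fun i j => z i (f (e j)))
  rw [h0] at this
  rw [← Int.cast_zero, this]
  rfl

theorem minorNorm_ne_zero {m k : ℕ} (z : Fin k → Fin m → ℤ)
    (hz : LinearIndependent ℚ fun i => toRat m (z i)) : minorNorm z ≠ 0 := by
  obtain ⟨f, hf⟩ := exists_det_ne_zero z hz
  have := natAbs_det_le_minorNorm z f
  have h : 0 < (Matrix.det (Matrix.of fun i j => z i (f j))).natAbs := Int.natAbs_pos.2 hf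
  omega

theorem minorNorm_cons_le {m k : ℕ} (u : Fin k → Fin m → ℤ) (v : Fin m → ℤ) :
    minorNorm (Fin.cons v u : Fin (k + 1) → Fin m → ℤ) ≤
      (k + 1) * minorNorm u * vecHeight v := by
  refine Finset.sup_le fun f _ => ?_
  rw [det_cons_eq]
  refine (Int.natAbs_sum_le _ _).trans ?_
  calc _ ≤ ∑ j : Fin (k + 1), minorNorm u * vecHeight v := by
        refine Finset.sum_le_sum fun j _ => ?_
        rw [Int.natAbs_mul, Int.natAbs_mul, Int.natAbs_pow, Int.natAbs_neg, Int.natAbs_one, one_pow,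
          one_mul, mul_comm]
        exact Nat.mul_le_mul (natAbs_det_le_minorNorm u fun j' => f (j.succAbove j'))
          (natAbs_le_vecHeight v _)
    _ = _ := by simp [mul_assoc]

/-- A tuple of integer vectors forming a rational basis of the subspace `V`. -/
structure IsIntBasis {m k : ℕ} (V : Submodule ℚ (Fin m → ℚ)) (z : Fin k → Fin m → ℤ) : Prop where
  card_eq : k = finrank ℚ V
  mem : ∀ i, toRat m (z i) ∈ V
  indep : LinearIndependent ℚ fun i => toRat m (z i)

theorem IsIntBasis.span_eq {m k : ℕ} {V : Submodule ℚ (Fin m → ℚ)} {z : Fin k → Fin m → ℤ}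
    (h : IsIntBasis V z) : Submodule.span ℚ (Set.range fun i => toRat m (z i)) = V := by
  apply Submodule.eq_of_le_of_finrank_eq
  · rw [Submodule.span_le]
    rintro _ ⟨i, rfl⟩
    exact h.mem i
  · rw [finrank_span_eq_card h.indep, Fintype.card_fin, h.card_eq]

/-- The covolume, in sup norm, of the lattice of integer points of a rational subspace. -/
noncomputable def covol {m : ℕ} (V : Submodule ℚ (Fin m → ℚ)) : ℕ :=
  sInf {c | ∃ (k : ℕ) (z : Fin k → Fin m → ℤ), IsIntBasis V z ∧ c = minorNorm z}

theorem exists_smul_eq_toRat {m : ℕ} (x : Fin m → ℚ) :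
    ∃ (c : ℤ) (z : Fin m → ℤ), c ≠ 0 ∧ toRat m z = (c : ℚ) • x := by
  obtain ⟨b, hb⟩ := IsLocalization.exist_integer_multiples_of_finite (nonZeroDivisors ℤ) x
  choose z hz using hb
  refine ⟨b, z, nonZeroDivisors.coe_ne_zero b, ?_⟩
  ext i
  have := hz i
  simpa [Algebra.smul_def] using this

theorem exists_isIntBasis {m : ℕ} (V : Submodule ℚ (Fin m → ℚ)) :
    ∃ (k : ℕ) (z : Fin k → Fin m → ℤ), IsIntBasis V z := by
  let b := Module.finBasis ℚ V
  choose c z hc hz using fun i => exists_smul_eq_toRat ((b i : V) : Fin m → ℚ)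
  refine ⟨finrank ℚ V, z, rfl, fun i => ?_, ?_⟩
  · rw [hz]
    exact V.smul_mem _ (b i).2
  · have h1 : LinearIndependent ℚ fun i => ((b i : V) : Fin m → ℚ) :=
      b.linearIndependent.map' V.subtype (Submodule.ker_subtype V)
    have h2 := h1.units_smul fun i => Units.mk0 ((c i : ℤ) : ℚ) (by exact_mod_cast hc i)
    convert h2 using 1
    ext i j
    rw [hz]
    rfl

theorem exists_covol_eq {m : ℕ} (V : Submodule ℚ (Fin m → ℚ)) :
    ∃ (k : ℕ) (z : Fin k → Fin m → ℤ), IsIntBasis V z ∧ covol V = minorNorm z := by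
  obtain ⟨k, z, h⟩ := exists_isIntBasis V
  exact Nat.sInf_mem (s := {c | ∃ (k : ℕ) (z : Fin k → Fin m → ℤ), IsIntBasis V z ∧
    c = minorNorm z}) ⟨_, k, z, h, rfl⟩

theorem covol_le {m k : ℕ} {V : Submodule ℚ (Fin m → ℚ)} {z : Fin k → Fin m → ℤ}
    (h : IsIntBasis V z) : covol V ≤ minorNorm z :=
  Nat.sInf_le ⟨k, z, h, rfl⟩

theorem one_le_covol {m : ℕ} (V : Submodule ℚ (Fin m → ℚ)) : 1 ≤ covol V := by
  obtain ⟨k, z, h, h'⟩ := exists_covol_eq V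
  rw [h']
  exact Nat.one_le_iff_ne_zero.2 (minorNorm_ne_zero z h.indep)

theorem covol_bot_le {m : ℕ} : covol (⊥ : Submodule ℚ (Fin m → ℚ)) ≤ 1 := by
  obtain ⟨k, z, h⟩ := exists_isIntBasis (⊥ : Submodule ℚ (Fin m → ℚ))
  have hk : k = 0 := by rw [h.card_eq, finrank_bot]
  subst hk
  refine (covol_le h).trans (Finset.sup_le fun f _ => ?_)
  simp

theorem exists_covol_mul_le {m : ℕ} (U : Submodule ℚ (Fin m → ℚ)) (v : Fin m → ℤ)
    (hv : toRat m v ∉ U) :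
    ∃ (M : ℕ) (w u : Fin m → ℤ), 0 < M ∧ toRat m u ∈ U ∧ M • w + u = v ∧
      (∀ P, toRat m P ∈ U ⊔ Submodule.span ℚ {toRat m v} → ∃ t : ℤ, toRat m (P - t • w) ∈ U) ∧
      finrank ℚ ↥(U ⊔ Submodule.span ℚ {toRat m v}) = finrank ℚ U + 1 ∧
      covol (U ⊔ Submodule.span ℚ {toRat m v}) * M ≤
        (finrank ℚ U + 1) * covol U * vecHeight v := by
  set W := U ⊔ Submodule.span ℚ {toRat m v} with hW
  obtain ⟨k, u, hu, hcu⟩ := exists_covol_eq U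
  have hvW : toRat m v ∈ W := (le_sup_right : _ ≤ W) (Submodule.mem_span_singleton_self _)
  have hUW : U ≤ W := le_sup_left
  have hcons : ∀ x : Fin m → ℤ, toRat m x ∉ U → LinearIndependent ℚ fun i =>
      toRat m ((Fin.cons x u : Fin (k + 1) → Fin m → ℤ) i) := by
    intro x hx
    have h := hu.indep.finCons (x := toRat m x) (by rwa [hu.span_eq])
    have heq : (fun i => toRat m ((Fin.cons x u : Fin (k + 1) → Fin m → ℤ) i)) =
        Fin.cons (toRat m x) fun i => toRat m (u i) := by
      funext i
      refine Fin.cases ?_ (fun i => ?_) i <;> simp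
    rw [heq]
    exact h
  have hrk : finrank ℚ W = finrank ℚ U + 1 := by
    have h := finrank_span_eq_card (hcons v hv)
    rw [Fintype.card_fin] at h
    have : Submodule.span ℚ (Set.range fun i =>
      toRat m ((Fin.cons v u : Fin (k + 1) → Fin m → ℤ) i)) = W := by
      rw [Fin.range_fin_succ, Fin.cons_zero, Submodule.span_insert, hW, sup_comm]
      rw [← hu.span_eq]
      rfl
    rw [← hu.card_eq, ← h, this]
  obtain ⟨f, hf⟩ := exists_det_ne_zero _ (hcons v hv)
  set D := minorForm u f with hD
  have hDv : D (toRat m v) ≠ 0 := by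
    rw [hD, minorForm_toRat]; exact_mod_cast hf
  have hDU : ∀ x ∈ U, D x = 0 := fun x hx => minorForm_eq_zero u f (by rwa [hu.span_eq])
  have hker : ∀ x ∈ W, D x = 0 → x ∈ U := by
    intro x hx hx0
    rw [hW, Submodule.mem_sup] at hx
    obtain ⟨y, hy, z, hz, rfl⟩ := hx
    obtain ⟨c, rfl⟩ := Submodule.mem_span_singleton.1 hz
    rw [map_add, hDU y hy, zero_add, map_smul, smul_eq_mul, mul_eq_zero] at hx0
    rcases hx0 with rfl | h
    · simpa using hy
    · exact absurd h hDv
  let DZ : (Fin m → ℤ) → ℤ := fun x =>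
    Matrix.det (Matrix.of fun i j => (Fin.cons x u : Fin (k + 1) → Fin m → ℤ) i (f j))
  have hDZ : ∀ x, ((DZ x : ℤ) : ℚ) = D (toRat m x) := fun x => (minorForm_toRat u f x).symm
  let H : AddSubgroup ℤ :=
    { carrier := {t | ∃ x, toRat m x ∈ W ∧ DZ x = t}
      zero_mem' := ⟨0, by simp, by
        have := hDZ 0
        rw [map_zero, map_zero] at this
        exact_mod_cast this⟩
      add_mem' := by
        rintro _ _ ⟨x, hx, rfl⟩ ⟨y, hy, rfl⟩
        refine ⟨x + y, by rw [map_add]; exact W.add_mem hx hy, ?_⟩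
        have := hDZ (x + y)
        rw [map_add, map_add, ← hDZ, ← hDZ] at this
        exact_mod_cast this
      neg_mem' := by
        rintro _ ⟨x, hx, rfl⟩
        refine ⟨-x, by rw [map_neg]; exact W.neg_mem hx, ?_⟩
        have := hDZ (-x)
        rw [map_neg, map_neg, ← hDZ] at this
        exact_mod_cast this }
  obtain ⟨g, hg⟩ := Int.subgroup_cyclic H
  have hgen : ∀ x, toRat m x ∈ W → ∃ t : ℤ, DZ x = t * g := by
    intro x hx
    have : DZ x ∈ H := ⟨x, hx, rfl⟩
    rw [hg, AddSubgroup.mem_closure_singleton] at this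
    obtain ⟨t, ht⟩ := this
    exact ⟨t, by rw [← ht, smul_eq_mul]⟩
  obtain ⟨w₀, hw₀, hw₀g⟩ : g ∈ H := by
    rw [hg]; exact AddSubgroup.mem_closure_singleton_self g
  obtain ⟨t₀, ht₀⟩ := hgen v hvW
  have ht₀0 : t₀ ≠ 0 := by
    rintro rfl
    rw [zero_mul] at ht₀
    exact hf ht₀
  set w : Fin m → ℤ := t₀.sign • w₀ with hw
  have hwW : toRat m w ∈ W := by
    rw [hw, map_zsmul]
    exact W.toAddSubgroup.zsmul_mem hw₀ _
  have hDw : D (toRat m w) = t₀.sign * g := by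
    rw [hw, map_zsmul, map_zsmul, ← hDZ, hw₀g, zsmul_eq_mul]
  have hsign : ((t₀.sign : ℤ) : ℚ) * t₀.sign = 1 := by
    rcases lt_or_gt_of_ne ht₀0 with h | h
    · rw [Int.sign_eq_neg_one_of_neg h]; norm_num
    · rw [Int.sign_eq_one_of_pos h]; norm_num
  have habs : ((t₀.natAbs : ℕ) : ℚ) = t₀ * t₀.sign := by
    rw [Nat.cast_natAbs]
    exact_mod_cast (Int.mul_sign_self t₀).symm
  have huU : toRat m (v - t₀.natAbs • w) ∈ U := by
    apply hker
    · rw [map_sub, map_nsmul]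
      exact W.sub_mem hvW (W.toAddSubgroup.nsmul_mem hwW _)
    · rw [map_sub, map_sub, map_nsmul, map_nsmul, hDw, ← hDZ, ht₀, nsmul_eq_mul, habs]
      push_cast
      linear_combination -(t₀ * g : ℚ) * hsign
  refine ⟨t₀.natAbs, w, v - t₀.natAbs • w, Int.natAbs_pos.2 ht₀0, huU, by abel, ?_, hrk, ?_⟩
  · intro P hP
    obtain ⟨t, ht⟩ := hgen P hP
    refine ⟨t * t₀.sign, ?_⟩
    apply hker
    · rw [map_sub, map_zsmul]
      exact W.sub_mem hP (W.toAddSubgroup.zsmul_mem hwW _)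
    · rw [map_sub, map_sub, map_zsmul, map_zsmul, hDw, ← hDZ, ht, zsmul_eq_mul]
      push_cast
      linear_combination -(t * g : ℚ) * hsign
  · have hwU : toRat m w ∉ U := by
      intro h
      have h0 := hDU _ h
      have h1 := hDU _ huU
      rw [map_sub, map_sub, map_nsmul, map_nsmul, h0, smul_zero, sub_zero] at h1
      exact hDv h1
    have hbas : IsIntBasis W (Fin.cons w u : Fin (k + 1) → Fin m → ℤ) := by
      refine ⟨by rw [hrk, hu.card_eq], fun i => ?_, hcons w hwU⟩
      refine Fin.cases ?_ (fun i => ?_) i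
      · simpa using hwW
      · simpa using hUW (hu.mem i)
    have h1 := covol_le hbas
    have h2 : minorNorm (Fin.cons w u : Fin (k + 1) → Fin m → ℤ) * t₀.natAbs ≤
        minorNorm (Fin.cons v u : Fin (k + 1) → Fin m → ℤ) := by
      obtain ⟨f', -, hf'⟩ := Finset.exists_mem_eq_sup Finset.univ
        ⟨f, Finset.mem_univ f⟩ fun f : Fin (k + 1) → Fin m => (Matrix.det (Matrix.of fun i j =>
          (Fin.cons w u : Fin (k + 1) → Fin m → ℤ) i (f j))).natAbs
      rw [minorNorm, hf']
      refine le_trans (le_of_eq ?_) (natAbs_det_le_minorNorm _ f')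
      have h3 := minorForm_toRat u f' v
      have h4 : minorForm u f' (toRat m v) = t₀.natAbs * minorForm u f' (toRat m w) := by
        have h5 := minorForm_eq_zero u f' (x := toRat m (v - t₀.natAbs • w)) (by rwa [hu.span_eq])
        rw [map_sub, map_sub, map_nsmul, map_nsmul, sub_eq_zero, nsmul_eq_mul] at h5
        exact h5
      rw [h4, minorForm_toRat] at h3
      have h6 : (t₀.natAbs : ℤ) * Matrix.det (Matrix.of fun i j =>
          (Fin.cons w u : Fin (k + 1) → Fin m → ℤ) i (f' j)) = Matrix.det (Matrix.of fun i j =>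
          (Fin.cons v u : Fin (k + 1) → Fin m → ℤ) i (f' j)) := by
        rw [← Int.cast_inj (α := ℚ), ← h3, Int.cast_mul, Int.cast_natCast]
      rw [← h6, Int.natAbs_mul, Int.natAbs_natCast, mul_comm]
    calc covol W * t₀.natAbs ≤ _ := Nat.mul_le_mul_right _ h1
      _ ≤ _ := h2
      _ ≤ _ := minorNorm_cons_le u v
      _ = _ := by rw [hcu, ← hu.card_eq]

end Covolume

section LocalSize

open Module

variable {p : ℕ} [Fact p.Prime] {m : ℕ}

/-- The weighted size of a pair of vectors with respect to two `p`-adic linear forms `e`, `e'`. -/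
noncomputable def localSize (a b : ℕ) (e e' : (Fin m → ℤ) →+ ℚ_[p]) (y z : Fin m → ℤ) : ℝ :=
  max (max 1 ((p : ℝ) ^ a * ‖e y‖))
    (max ((p : ℝ) ^ b * ‖e' y‖) ((p : ℝ) ^ (a + b) * ‖e y * e' z - e' y * e z‖))

/-- The largest local size of a pair of integer vectors of the subspace `V`. -/
noncomputable def localSup (a b : ℕ) (e e' : (Fin m → ℤ) →+ ℚ_[p])
    (V : Submodule ℚ (Fin m → ℚ)) : ℝ :=
  ⨆ q : {q : (Fin m → ℤ) × (Fin m → ℤ) // toRat m q.1 ∈ V ∧ toRat m q.2 ∈ V},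
    localSize a b e e' q.1.1 q.1.2

theorem norm_sub_le_max_padic (s t : ℚ_[p]) : ‖s - t‖ ≤ max ‖s‖ ‖t‖ := by
  have := Padic.nonarchimedean s (-t)
  rwa [← sub_eq_add_neg, norm_neg] at this

theorem one_le_cast_prime : (1 : ℝ) ≤ p := by
  exact_mod_cast (Fact.out : p.Prime).one_lt.le

theorem localSize_le_pow {a b : ℕ} {e e' : (Fin m → ℤ) →+ ℚ_[p]} (he : ∀ z, ‖e z‖ ≤ 1)
    (he' : ∀ z, ‖e' z‖ ≤ 1) (y z : Fin m → ℤ) : localSize a b e e' y z ≤ (p : ℝ) ^ (a + b) := by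
  have hp := one_le_cast_prime (p := p)
  have h1 : (p : ℝ) ^ a ≤ (p : ℝ) ^ (a + b) := pow_le_pow_right₀ hp (by omega)
  have h2 : (p : ℝ) ^ b ≤ (p : ℝ) ^ (a + b) := pow_le_pow_right₀ hp (by omega)
  refine max_le (max_le (one_le_pow₀ hp) ?_) (max_le ?_ ?_)
  · exact (mul_le_of_le_one_right (by positivity) (he y)).trans h1
  · exact (mul_le_of_le_one_right (by positivity) (he' y)).trans h2
  · refine mul_le_of_le_one_right (by positivity) ?_
    refine (norm_sub_le_max_padic _ _).trans (max_le ?_ ?_)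
    · rw [norm_mul]
      exact mul_le_one₀ (he _) (norm_nonneg _) (he' _)
    · rw [norm_mul]
      exact mul_le_one₀ (he' _) (norm_nonneg _) (he _)

theorem bddAbove_localSize {a b : ℕ} {e e' : (Fin m → ℤ) →+ ℚ_[p]} (he : ∀ z, ‖e z‖ ≤ 1)
    (he' : ∀ z, ‖e' z‖ ≤ 1) (V : Submodule ℚ (Fin m → ℚ)) : BddAbove (Set.range
    fun q : {q : (Fin m → ℤ) × (Fin m → ℤ) // toRat m q.1 ∈ V ∧ toRat m q.2 ∈ V} =>
      localSize a b e e' q.1.1 q.1.2) := by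
  refine ⟨(p : ℝ) ^ (a + b), ?_⟩
  rintro _ ⟨q, rfl⟩
  exact localSize_le_pow he he' _ _

theorem localSize_le_localSup {a b : ℕ} {e e' : (Fin m → ℤ) →+ ℚ_[p]} (he : ∀ z, ‖e z‖ ≤ 1)
    (he' : ∀ z, ‖e' z‖ ≤ 1) {V : Submodule ℚ (Fin m → ℚ)} {y z : Fin m → ℤ}
    (hy : toRat m y ∈ V) (hz : toRat m z ∈ V) :
    localSize a b e e' y z ≤ localSup a b e e' V :=
  le_ciSup (bddAbove_localSize he he' V) ⟨(y, z), hy, hz⟩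

theorem one_le_localSize (a b : ℕ) (e e' : (Fin m → ℤ) →+ ℚ_[p]) (y z : Fin m → ℤ) :
    1 ≤ localSize a b e e' y z :=
  (le_max_left _ _).trans (le_max_left _ _)

theorem one_le_localSup {a b : ℕ} {e e' : (Fin m → ℤ) →+ ℚ_[p]} (he : ∀ z, ‖e z‖ ≤ 1)
    (he' : ∀ z, ‖e' z‖ ≤ 1) (V : Submodule ℚ (Fin m → ℚ)) : 1 ≤ localSup a b e e' V :=
  (one_le_localSize a b e e' 0 0).trans (localSize_le_localSup he he' (by simp) (by simp))

theorem localSup_le {a b : ℕ} {e e' : (Fin m → ℤ) →+ ℚ_[p]} {V : Submodule ℚ (Fin m → ℚ)}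
    {c : ℝ} (h : ∀ y z, toRat m y ∈ V → toRat m z ∈ V → localSize a b e e' y z ≤ c) :
    localSup a b e e' V ≤ c := by
  have : Nonempty {q : (Fin m → ℤ) × (Fin m → ℤ) // toRat m q.1 ∈ V ∧ toRat m q.2 ∈ V} :=
    ⟨⟨(0, 0), by simp, by simp⟩⟩
  exact ciSup_le fun q => h _ _ q.2.1 q.2.2

theorem localSup_bot_le (a b : ℕ) (e e' : (Fin m → ℤ) →+ ℚ_[p]) :
    localSup a b e e' ⊥ ≤ 1 := by
  refine localSup_le fun y z hy _ => ?_
  have : y = 0 := toRat_injective m (by simpa using hy)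
  subst this
  simp [localSize]

theorem natCast_inv_norm_le {M : ℕ} (hM : 0 < M) : ‖(M : ℚ_[p])‖⁻¹ ≤ M := by
  have h0 : (M : ℚ_[p]) ≠ 0 := by exact_mod_cast hM.ne'
  rw [Padic.norm_eq_zpow_neg_valuation h0, zpow_neg, inv_inv, Padic.valuation_natCast,
    zpow_natCast]
  exact_mod_cast Nat.le_of_dvd hM pow_padicValNat_dvd

theorem localSup_sup_span_le {a b : ℕ} {e e' : (Fin m → ℤ) →+ ℚ_[p]} (he : ∀ z, ‖e z‖ ≤ 1)
    (he' : ∀ z, ‖e' z‖ ≤ 1) {U W : Submodule ℚ (Fin m → ℚ)} {M : ℕ} {v w u : Fin m → ℤ}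
    (hM : 0 < M) (hu : toRat m u ∈ U) (hv : M • w + u = v)
    (hW : ∀ P, toRat m P ∈ W → ∃ t : ℤ, toRat m (P - t • w) ∈ U)
    (hev : (p : ℝ) ^ a * ‖e v‖ ≤ 1) (hev' : (p : ℝ) ^ b * ‖e' v‖ ≤ 1) :
    localSup a b e e' W ≤ M * localSup a b e e' U := by
  set T := localSup a b e e' U with hT
  have hT1 : 1 ≤ T := one_le_localSup he he' U
  have hM1 : (1 : ℝ) ≤ M := by exact_mod_cast hM
  have hM0 : (M : ℚ_[p]) ≠ 0 := by exact_mod_cast hM.ne'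
  have hTM : T ≤ M * T := le_mul_of_one_le_left (by linarith) hM1
  have hU : ∀ z, toRat m z ∈ U → (p : ℝ) ^ a * ‖e z‖ ≤ T := fun z hz =>
    ((le_max_right _ _).trans (le_max_left _ _)).trans (localSize_le_localSup he he' hz hz)
  have hU' : ∀ z, toRat m z ∈ U → (p : ℝ) ^ b * ‖e' z‖ ≤ T := fun z hz =>
    ((le_max_left _ _).trans (le_max_right _ _)).trans (localSize_le_localSup he he' hz hz)
  have hUU : ∀ y z, toRat m y ∈ U → toRat m z ∈ U →
      (p : ℝ) ^ (a + b) * ‖e y * e' z - e' y * e z‖ ≤ T := fun y z hy hz =>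
    ((le_max_right _ _).trans (le_max_right _ _)).trans (localSize_le_localSup he he' hy hz)
  have hmul : ∀ (c : ℝ) (s : ℚ_[p]), 0 ≤ c → c * ‖(M : ℚ_[p]) * s‖ ≤ T → c * ‖s‖ ≤ M * T := by
    intro c s hc h
    have h1 : c * ‖s‖ = ‖(M : ℚ_[p])‖⁻¹ * (c * ‖(M : ℚ_[p]) * s‖) := by
      rw [norm_mul]
      field_simp [norm_ne_zero_iff.2 hM0]
    rw [h1]
    exact mul_le_mul (natCast_inv_norm_le hM) h (by positivity) (by positivity)
  have hsub : ∀ (c : ℝ) (s t : ℚ_[p]) (r : ℝ), 0 ≤ c → c * ‖s‖ ≤ r → c * ‖t‖ ≤ r →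
      c * ‖s - t‖ ≤ r := by
    intro c s t r hc hs ht
    refine (mul_le_mul_of_nonneg_left (norm_sub_le_max_padic s t) hc).trans ?_
    rw [mul_max_of_nonneg _ _ hc]
    exact max_le hs ht
  have hadd : ∀ (c : ℝ) (s t : ℚ_[p]) (r : ℝ), 0 ≤ c → c * ‖s‖ ≤ r → c * ‖t‖ ≤ r →
      c * ‖s + t‖ ≤ r := by
    intro c s t r hc hs ht
    have := hsub c s (-t) r hc hs (by rwa [norm_neg])
    rwa [sub_neg_eq_add] at this
  have hpa : (0 : ℝ) ≤ (p : ℝ) ^ a := by positivity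
  have hpb : (0 : ℝ) ≤ (p : ℝ) ^ b := by positivity
  have hpab : (0 : ℝ) ≤ (p : ℝ) ^ (a + b) := by positivity
  have eMw : (M : ℚ_[p]) * e w = e v - e u := by
    rw [← hv, map_add, map_nsmul, nsmul_eq_mul, add_sub_cancel_right]
  have eMw' : (M : ℚ_[p]) * e' w = e' v - e' u := by
    rw [← hv, map_add, map_nsmul, nsmul_eq_mul, add_sub_cancel_right]
  have hw : (p : ℝ) ^ a * ‖e w‖ ≤ M * T := by
    refine hmul _ _ hpa ?_
    rw [eMw]
    exact hsub _ _ _ _ hpa (hev.trans hT1) (hU u hu)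
  have hw' : (p : ℝ) ^ b * ‖e' w‖ ≤ M * T := by
    refine hmul _ _ hpb ?_
    rw [eMw']
    exact hsub _ _ _ _ hpb (hev'.trans hT1) (hU' u hu)
  have hcast_le : ∀ (c : ℝ) (s : ℚ_[p]) (t : ℤ) (r : ℝ), 0 ≤ c → c * ‖s‖ ≤ r →
      c * ‖(t : ℚ_[p]) * s‖ ≤ r := by
    intro c s t r hc h
    rw [norm_mul]
    refine le_trans (mul_le_mul_of_nonneg_left ?_ hc) h
    exact mul_le_of_le_one_left (norm_nonneg _) (Padic.norm_int_le_one t)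
  refine localSup_le fun P P' hP hP' => ?_
  obtain ⟨t, ht⟩ := hW P hP
  obtain ⟨t', ht'⟩ := hW P' hP'
  set y := P - t • w with hy
  set y' := P' - t' • w with hy'
  have ePt : ∀ f : (Fin m → ℤ) →+ ℚ_[p], f P = f y + t * f w := by
    intro f
    rw [hy, map_sub, map_zsmul, zsmul_eq_mul, sub_add_cancel]
  have ePt' : ∀ f : (Fin m → ℤ) →+ ℚ_[p], f P' = f y' + t' * f w := by
    intro f
    rw [hy', map_sub, map_zsmul, zsmul_eq_mul, sub_add_cancel]
  refine max_le (max_le (hT1.trans hTM) ?_) (max_le ?_ ?_)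
  · rw [ePt e]
    exact hadd _ _ _ _ hpa ((hU y ht).trans hTM) (hcast_le _ _ _ _ hpa hw)
  · rw [ePt e']
    exact hadd _ _ _ _ hpb ((hU' y ht).trans hTM) (hcast_le _ _ _ _ hpb hw')
  · set q := t' • y - t • y' with hq
    have hqU : toRat m q ∈ U := by
      rw [hq, map_sub, map_zsmul, map_zsmul]
      exact U.sub_mem (U.toAddSubgroup.zsmul_mem ht _) (U.toAddSubgroup.zsmul_mem ht' _)
    have eq : ∀ f : (Fin m → ℤ) →+ ℚ_[p], f q = t' * f y - t * f y' := by
      intro f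
      rw [hq, map_sub, map_zsmul, map_zsmul, zsmul_eq_mul, zsmul_eq_mul]
    have key : e P * e' P' - e' P * e P' =
        (e y * e' y' - e' y * e y') + (e q * e' w - e' q * e w) := by
      rw [ePt e, ePt e', ePt' e, ePt' e', eq e, eq e']
      ring
    have key2 : (M : ℚ_[p]) * (e q * e' w - e' q * e w) =
        (e q * e' v - e' q * e v) - (e q * e' u - e' q * e u) := by
      linear_combination e q * eMw' - e' q * eMw
    rw [key]
    refine hadd _ _ _ _ hpab ((hUU y y' ht ht').trans hTM) (hmul _ _ hpab ?_)
    rw [key2]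
    refine hsub _ _ _ _ hpab (hsub _ _ _ _ hpab ?_ ?_) (hUU q u hqU hu)
    · have h := mul_le_mul (hU q hqU) hev' (by positivity) (by linarith)
      rw [norm_mul, pow_add]
      linarith
    · have h := mul_le_mul (hU' q hqU) hev (by positivity) (by linarith)
      rw [norm_mul, pow_add]
      linarith

/-- Covolume times local size, normalised by a power of `Q`. -/
noncomputable def subspaceSize (a b : ℕ) (e e' : (Fin m → ℤ) →+ ℚ_[p]) (Q : ℝ)
    (V : Submodule ℚ (Fin m → ℚ)) : ℝ :=
  covol V * localSup a b e e' V / Q ^ finrank ℚ V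

theorem subspaceSize_sup_span_le {a b : ℕ} {e e' : (Fin m → ℤ) →+ ℚ_[p]} (he : ∀ z, ‖e z‖ ≤ 1)
    (he' : ∀ z, ‖e' z‖ ≤ 1) {Q : ℝ} (hQ : 0 < Q) (U : Submodule ℚ (Fin m → ℚ)) (v : Fin m → ℤ)
    (hvU : toRat m v ∉ U) (hev : (p : ℝ) ^ a * ‖e v‖ ≤ 1) (hev' : (p : ℝ) ^ b * ‖e' v‖ ≤ 1) :
    subspaceSize a b e e' Q (U ⊔ Submodule.span ℚ {toRat m v}) ≤
      m * subspaceSize a b e e' Q U * vecHeight v / Q := by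
  obtain ⟨M, w, u, hM, hu, hv, hW, hrk, hcov⟩ := exists_covol_mul_le U v hvU
  have h1 := localSup_sup_span_le he he' hM hu hv hW hev hev'
  have h2 : finrank ℚ U + 1 ≤ m := by
    have := Submodule.finrank_le (U ⊔ Submodule.span ℚ {toRat m v})
    rw [hrk] at this
    simpa using this
  have hT := one_le_localSup (a := a) (b := b) he he' U
  have hcov' : ((covol (U ⊔ Submodule.span ℚ {toRat m v}) : ℕ) : ℝ) * M ≤
      m * covol U * vecHeight v := by
    have : covol (U ⊔ Submodule.span ℚ {toRat m v}) * M ≤ m * covol U * vecHeight v :=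
      hcov.trans (by gcongr)
    exact_mod_cast this
  rw [subspaceSize, subspaceSize, hrk, pow_succ, div_le_iff₀ (by positivity)]
  calc _ ≤ ((covol (U ⊔ Submodule.span ℚ {toRat m v}) : ℕ) : ℝ) *
        (M * localSup a b e e' U) := by gcongr
    _ = (((covol (U ⊔ Submodule.span ℚ {toRat m v}) : ℕ) : ℝ) * M) * localSup a b e e' U := by
        ring
    _ ≤ (m * covol U * vecHeight v) * localSup a b e e' U := by gcongr
    _ = _ := by field_simp

theorem lt_vecHeight_of_hasFlag {X : Type*} {a b : ℕ} {e e' : X → (Fin m → ℤ) →+ ℚ_[p]}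
    (he : ∀ x z, ‖e x z‖ ≤ 1) (he' : ∀ x z, ‖e' x z‖ ≤ 1) {Q : ℝ} (hQ : 0 < Q) {σ : ℝ} {x : X}
    (h : HasFlag (fun V x => subspaceSize a b (e x) (e' x) Q V) {V | V ≠ ⊥} 1 σ x)
    {v : Fin m → ℤ} (hv0 : v ≠ 0) (hev : (p : ℝ) ^ a * ‖e x v‖ ≤ 1)
    (hev' : (p : ℝ) ^ b * ‖e' x v‖ ≤ 1) : σ * Q < m * vecHeight v := by
  obtain ⟨G, hGS, hG, hle, hlt⟩ := h
  have hv0' : toRat m v ≠ 0 := fun h0 => hv0 (toRat_injective m (by rw [h0, map_zero]))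
  obtain ⟨U, ⟨hUG, hvU⟩, hUmax⟩ : ∃ U ∈ {U | U ∈ insert ⊥ G ∧ toRat m v ∉ U},
      ∀ V ∈ {U | U ∈ insert ⊥ G ∧ toRat m v ∉ U}, finrank ℚ V ≤ finrank ℚ U := by
    have hfin : ((fun U : Submodule ℚ (Fin m → ℚ) => finrank ℚ U) ''
        {U | U ∈ insert ⊥ G ∧ toRat m v ∉ U}).Finite := by
      refine (Set.finite_Iic m).subset ?_
      rintro _ ⟨U, -, rfl⟩
      simpa using Submodule.finrank_le U
    obtain ⟨d, ⟨U, hU, rfl⟩, hd⟩ := hfin.exists_maximal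
      ⟨_, ⊥, ⟨Set.mem_insert _ _, by simpa using hv0'⟩, rfl⟩
    refine ⟨U, hU, fun V hV => ?_⟩
    by_contra! hlt'
    exact absurd (hd ⟨V, hV, rfl⟩ hlt'.le) (not_le.2 hlt')
  have hUle : subspaceSize a b (e x) (e' x) Q U ≤ 1 := by
    rcases hUG with rfl | hU
    · rw [subspaceSize, finrank_bot, pow_zero, div_one]
      exact mul_le_one₀ (by exact_mod_cast covol_bot_le)
        (zero_le_one.trans (one_le_localSup (he x) (he' x) _)) (localSup_bot_le _ _ _ _)
    · exact hle U hU
  have hcomp : ∀ V ∈ G, U ⊔ Submodule.span ℚ {toRat m v} ≤ V ∨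
      V ≤ U ⊔ Submodule.span ℚ {toRat m v} := by
    intro V hV
    have hUV : U ≤ V ∨ V ≤ U := by
      rcases hUG with rfl | hU
      · exact Or.inl bot_le
      · by_cases hne : U = V
        · exact Or.inl hne.le
        · exact hG hU hV hne
    by_cases hvV : toRat m v ∈ V
    · rcases hUV with h | h
      · exact Or.inl (sup_le h ((Submodule.span_singleton_le_iff_mem _ _).2 hvV))
      · exact absurd (h hvV) hvU
    · right
      refine le_trans ?_ le_sup_left
      rcases hUV with h | h
      · exact (Submodule.eq_of_le_of_finrank_le h
          (hUmax V ⟨Set.mem_insert_of_mem _ hV, hvV⟩)).ge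
      · exact h
  have hWne : U ⊔ Submodule.span ℚ {toRat m v} ≠ ⊥ := by
    intro h0
    have : toRat m v ∈ (⊥ : Submodule ℚ (Fin m → ℚ)) := by
      rw [← h0]
      exact (le_sup_right : _ ≤ U ⊔ _) (Submodule.mem_span_singleton_self _)
    exact hv0' (by simpa using this)
  have h1 := hlt _ hWne hcomp
  have h2 := subspaceSize_sup_span_le (he x) (he' x) hQ U v hvU hev hev'
  have h3 : (m : ℝ) * subspaceSize a b (e x) (e' x) Q U * vecHeight v / Q ≤
      m * 1 * vecHeight v / Q := by gcongr
  have h4 := (h1.trans_le h2).trans_le h3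
  rw [mul_one, lt_div_iff₀ hQ] at h4
  exact h4

end LocalSize

section Goodness

open Module

variable {p : ℕ} [Fact p.Prime] {m : ℕ}

theorem norm_aeval_sub_le (f : ℤ[X]) {x y j : ℕ} (h : x ≡ y [MOD p ^ j]) :
    ‖aeval (x : ℚ_[p]) f - aeval (y : ℚ_[p]) f‖ ≤ (p : ℝ) ^ (-(j : ℤ)) := by
  have h1 : ((p ^ j : ℕ) : ℤ) ∣ f.eval (x : ℤ) - f.eval (y : ℤ) :=
    ((Nat.modEq_iff_dvd.1 h.symm)).trans (sub_dvd_eval_sub _ _ f)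
  have h2 : ∀ z : ℕ, aeval (z : ℚ_[p]) f = ((f.eval (z : ℤ) : ℤ) : ℚ_[p]) := by
    intro z
    have := aeval_algebraMap_apply ℚ_[p] (z : ℤ) f
    simpa using this
  rw [h2, h2, ← Int.cast_sub, Padic.norm_int_le_pow_iff_dvd]
  exact_mod_cast h1

theorem card_le_of_norm_aeval_le {N s l d A : ℕ} (hN : s + l ≤ N) {f : ℤ[X]}
    (hd : f.natDegree ≤ d) (hA : A ≤ s) {x y : Fin (p ^ N)} {j : ℕ} (hy : y ∈ resBall p N x j)
    {R σ : ℝ} (hR1 : 1 ≤ R) (hσ0 : 0 ≤ σ) (hσ1 : σ ≤ 1) (hσ : (p : ℝ) ^ (l * d) * σ ≤ 1)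
    (hR : R < (p : ℝ) ^ A * ‖aeval ((y : ℕ) : ℚ_[p]) f‖) {S : Finset (Fin (p ^ N))}
    (hS : S ⊆ resBall p N x j)
    (hSf : ∀ z ∈ S, (p : ℝ) ^ A * ‖aeval ((z : ℕ) : ℚ_[p]) f‖ ≤ σ * R) :
    (S.card : ℝ) ≤ d / (p : ℝ) ^ l * (resBall p N x j).card := by
  have hp := (Fact.out : p.Prime).pos
  have hp0 : (0 : ℝ) < p := by exact_mod_cast hp
  have hA0 : (0 : ℝ) < (p : ℝ) ^ A := by positivity
  by_cases hj : j < s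
  · have hc : (p : ℝ) ^ (l * d) * (σ * R / (p : ℝ) ^ A) <
        ‖(f.map (algebraMap ℤ ℚ_[p])).eval ((y : ℕ) : ℚ_[p])‖ := by
      rw [eval_map_algebraMap]
      rw [mul_comm] at hR
      rw [← div_lt_iff₀ hA0] at hR
      refine lt_of_le_of_lt ?_ hR
      rw [← mul_div_assoc, ← mul_assoc]
      gcongr
      exact mul_le_of_le_one_left (by linarith) hσ
    have h := card_filter_norm_eval_le (f.map (algebraMap ℤ ℚ_[p]))
      (natDegree_map_le.trans hd) x y (by omega : j + l ≤ N) hy (by positivity) hc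
    have hsub : S ⊆ (resBall p N x j).filter fun z : Fin (p ^ N) =>
        ‖(f.map (algebraMap ℤ ℚ_[p])).eval ((z : ℕ) : ℚ_[p])‖ ≤ σ * R / (p : ℝ) ^ A := by
      intro z hz
      refine Finset.mem_filter.2 ⟨hS hz, ?_⟩
      rw [eval_map_algebraMap, le_div_iff₀ hA0, mul_comm]
      exact hSf z hz
    have h2 : (S.card : ℝ) ≤ (p : ℝ) ^ (N - (j + l)) * d := by
      exact_mod_cast (Finset.card_le_card hsub).trans h
    refine h2.trans (le_of_eq ?_)
    rw [card_resBall x j hp (by omega), Nat.cast_pow]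
    have : N - j = (N - (j + l)) + l := by omega
    rw [this, pow_add]
    field_simp
  · have : S = ∅ := by
      refine Finset.eq_empty_of_forall_notMem fun z hz => ?_
      have h1 := hSf z hz
      have hyx := mem_resBall.1 hy
      have hzx := mem_resBall.1 (hS hz)
      have h2 := norm_aeval_sub_le (p := p) f (hyx.trans hzx.symm)
      have h3 : ‖aeval ((y : ℕ) : ℚ_[p]) f‖ ≤ max ‖aeval ((z : ℕ) : ℚ_[p]) f‖
          ((p : ℝ) ^ (-(j : ℤ))) := by
        have := norm_sub_le_max_padic (aeval ((y : ℕ) : ℚ_[p]) f - aeval ((z : ℕ) : ℚ_[p]) f)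
          (-aeval ((z : ℕ) : ℚ_[p]) f)
        rw [sub_neg_eq_add, sub_add_cancel, norm_neg, max_comm] at this
        exact this.trans (max_le_max le_rfl h2)
      have h4 : (p : ℝ) ^ A * ‖aeval ((y : ℕ) : ℚ_[p]) f‖ ≤ R := by
        refine (mul_le_mul_of_nonneg_left h3 hA0.le).trans ?_
        rw [mul_max_of_nonneg _ _ hA0.le]
        refine max_le (h1.trans (mul_le_of_le_one_left (by linarith) hσ1)) (le_trans ?_ hR1)
        rw [← zpow_natCast, ← zpow_add₀ hp0.ne']
        exact zpow_le_one_of_nonpos₀ (one_le_cast_prime (p := p)) (by omega)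
      linarith
    rw [this, Finset.card_empty, Nat.cast_zero]
    positivity

/-- The integer polynomial with a given vector of coefficients. -/
noncomputable def intPoly (m : ℕ) : (Fin m → ℤ) →+ ℤ[X] where
  toFun z := ∑ i : Fin m, monomial (i : ℕ) (z i)
  map_zero' := by simp
  map_add' y z := by simp [Finset.sum_add_distrib]

theorem intPoly_apply (z : Fin m → ℤ) : intPoly m z = ∑ i : Fin m, monomial (i : ℕ) (z i) := rfl

theorem coeff_intPoly (z : Fin m → ℤ) (i : Fin m) : (intPoly m z).coeff i = z i := by
  rw [intPoly_apply, finsetSum_coeff, Finset.sum_eq_single i]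
  · simp
  · intro j _ hj
    rw [coeff_monomial, if_neg (fun h => hj (Fin.ext h))]
  · simp

theorem coeff_intPoly_of_le (z : Fin m → ℤ) {i : ℕ} (hi : m ≤ i) : (intPoly m z).coeff i = 0 := by
  rw [intPoly_apply, finsetSum_coeff]
  refine Finset.sum_eq_zero fun j _ => ?_
  rw [coeff_monomial, if_neg (by omega)]

theorem natDegree_intPoly_le (z : Fin m → ℤ) : (intPoly m z).natDegree ≤ m - 1 := by
  rw [natDegree_le_iff_coeff_eq_zero]
  intro i hi
  exact coeff_intPoly_of_le z (by omega)

/-- Evaluation of the polynomial with given coefficients. -/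
noncomputable def evalHom (p m : ℕ) [Fact p.Prime] (x : ℕ) : (Fin m → ℤ) →+ ℚ_[p] :=
  (aeval (x : ℚ_[p])).toRingHom.toAddMonoidHom.comp (intPoly m)

/-- Evaluation of the derivative of the polynomial with given coefficients. -/
noncomputable def derivHom (p m : ℕ) [Fact p.Prime] (x : ℕ) : (Fin m → ℤ) →+ ℚ_[p] :=
  (aeval (x : ℚ_[p])).toRingHom.toAddMonoidHom.comp
    ((derivative (R := ℤ)).toAddMonoidHom.comp (intPoly m))

theorem evalHom_apply (x : ℕ) (z : Fin m → ℤ) :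
    evalHom p m x z = aeval (x : ℚ_[p]) (intPoly m z) := rfl

theorem derivHom_apply (x : ℕ) (z : Fin m → ℤ) :
    derivHom p m x z = aeval (x : ℚ_[p]) (derivative (intPoly m z)) := rfl

theorem norm_aeval_natCast_le_one (x : ℕ) (f : ℤ[X]) : ‖aeval (x : ℚ_[p]) f‖ ≤ 1 := by
  have := aeval_algebraMap_apply ℚ_[p] (x : ℤ) f
  have h2 : aeval (x : ℚ_[p]) f = ((f.eval (x : ℤ) : ℤ) : ℚ_[p]) := by simpa using this
  rw [h2]
  exact Padic.norm_int_le_one _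

theorem norm_evalHom_le (x : ℕ) (z : Fin m → ℤ) : ‖evalHom p m x z‖ ≤ 1 :=
  norm_aeval_natCast_le_one _ _

theorem norm_derivHom_le (x : ℕ) (z : Fin m → ℤ) : ‖derivHom p m x z‖ ≤ 1 :=
  norm_aeval_natCast_le_one _ _

/-- The normalised size of `V` at the natural number `x`. -/
noncomputable def polySize (p m a b : ℕ) [Fact p.Prime] (Q : ℝ) (V : Submodule ℚ (Fin m → ℚ))
    (x : ℕ) : ℝ :=
  subspaceSize a b (evalHom p m x) (derivHom p m x) Q V

theorem aeval_wronskian_intPoly (x : ℕ) (y z : Fin m → ℤ) :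
    aeval (x : ℚ_[p]) (wronskian (intPoly m y) (intPoly m z)) =
      evalHom p m x y * derivHom p m x z - derivHom p m x y * evalHom p m x z := by
  rw [wronskian, map_sub, map_mul, map_mul]
  rfl

theorem natDegree_wronskian_intPoly_le (y z : Fin m → ℤ) :
    (wronskian (intPoly m y) (intPoly m z)).natDegree ≤ 2 * m := by
  have hy := natDegree_intPoly_le y
  have hz := natDegree_intPoly_le z
  have hy' := natDegree_derivative_le (intPoly m y)
  have hz' := natDegree_derivative_le (intPoly m z)
  rw [wronskian]
  refine (natDegree_sub_le _ _).trans (max_le ?_ ?_)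
  · refine natDegree_mul_le.trans ?_
    omega
  · refine natDegree_mul_le.trans ?_
    omega

open Classical in
theorem card_filter_polySize_le {N a b l : ℕ} (hN : a + b + l ≤ N) {Q σ : ℝ} (hQ : 0 < Q)
    (hσ0 : 0 ≤ σ) (hσ1 : σ ≤ 1) (hσ : (p : ℝ) ^ (l * (2 * m)) * σ ≤ 1)
    (V : Submodule ℚ (Fin m → ℚ)) (x : Fin (p ^ N)) (j : ℕ)
    (h : ∃ y ∈ resBall p N x j, 1 < polySize p m a b Q V y) :
    (((resBall p N x j).filter fun z : Fin (p ^ N) => polySize p m a b Q V z ≤ σ).card : ℝ) ≤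
      (2 * m : ℕ) / (p : ℝ) ^ l * (resBall p N x j).card := by
  obtain ⟨y, hy, hy1⟩ := h
  have hcov : (0 : ℝ) < covol V := by exact_mod_cast one_le_covol V
  set R : ℝ := Q ^ finrank ℚ V / covol V with hR
  have hRpos : 0 < R := by positivity
  have hbad : ∀ z : ℕ, polySize p m a b Q V z ≤ σ →
      localSup a b (evalHom p m z) (derivHom p m z) V ≤ σ * R := by
    intro z hz
    rw [polySize, subspaceSize, div_le_iff₀ (by positivity), mul_comm, ← le_div_iff₀ hcov] at hz
    rwa [hR, ← mul_div_assoc]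
  have hone : ∀ z : ℕ, 1 ≤ localSup a b (evalHom p m z) (derivHom p m z) V := fun z =>
    one_le_localSup (norm_evalHom_le z) (norm_derivHom_le z) V
  set S := (resBall p N x j).filter fun z : Fin (p ^ N) => polySize p m a b Q V z ≤ σ with hS
  by_cases hR1 : 1 ≤ R
  swap
  · have : S = ∅ := by
      refine Finset.eq_empty_of_forall_notMem fun z hz => ?_
      have h1 := hbad z (Finset.mem_filter.1 hz).2
      have h2 := hone z
      have h3 : σ * R ≤ R := mul_le_of_le_one_left hRpos.le hσ1
      linarith
    rw [this, Finset.card_empty, Nat.cast_zero]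
    positivity
  have hlt : R < localSup a b (evalHom p m y) (derivHom p m y) V := by
    rw [polySize, subspaceSize, lt_div_iff₀ (by positivity), one_mul] at hy1
    rwa [hR, div_lt_iff₀ hcov, mul_comm]
  have : Nonempty {q : (Fin m → ℤ) × (Fin m → ℤ) // toRat m q.1 ∈ V ∧ toRat m q.2 ∈ V} :=
    ⟨⟨(0, 0), by simp, by simp⟩⟩
  rw [localSup, lt_ciSup_iff (bddAbove_localSize (norm_evalHom_le _) (norm_derivHom_le _) V)] at hlt
  obtain ⟨⟨⟨u, v⟩, hu, hv⟩, huv⟩ := hlt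
  have key : ∀ z : Fin (p ^ N), z ∈ S → localSize a b (evalHom p m z) (derivHom p m z) u v ≤
      σ * R := fun z hz =>
    (localSize_le_localSup (norm_evalHom_le _) (norm_derivHom_le _) hu hv).trans
      (hbad z (Finset.mem_filter.1 hz).2)
  have hsub : S ⊆ resBall p N x j := Finset.filter_subset _ _
  simp only [localSize, lt_max_iff] at huv
  rcases huv with (huv | huv) | huv | huv
  · exact absurd huv (not_lt.2 hR1)
  · have hdeg : (intPoly m u).natDegree ≤ 2 * m := (natDegree_intPoly_le u).trans (by omega)
    exact card_le_of_norm_aeval_le hN hdeg (Nat.le_add_right a b) hy hR1 hσ0 hσ1 hσ huv hsub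
      fun z hz => ((le_max_right _ _).trans (le_max_left _ _)).trans (key z hz)
  · have hdeg : (derivative (intPoly m u)).natDegree ≤ 2 * m :=
      (natDegree_derivative_le _).trans ((Nat.sub_le _ _).trans
        ((natDegree_intPoly_le u).trans (by omega)))
    exact card_le_of_norm_aeval_le hN hdeg (Nat.le_add_left b a) hy hR1 hσ0 hσ1 hσ huv hsub
      fun z hz => ((le_max_left _ _).trans (le_max_right _ _)).trans (key z hz)
  · have hw := aeval_wronskian_intPoly (p := p) (y : ℕ) u v
    rw [← hw] at huv
    refine card_le_of_norm_aeval_le hN (natDegree_wronskian_intPoly_le u v) le_rfl hy hR1 hσ0 hσ1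
      hσ huv hsub fun z hz => ?_
    rw [aeval_wronskian_intPoly]
    exact ((le_max_right _ _).trans (le_max_right _ _)).trans (key z hz)

end Goodness

section LowerBound

open Module

variable {p : ℕ} [Fact p.Prime] {m : ℕ}

theorem exists_not_dvd_coord {V : Submodule ℚ (Fin m → ℚ)} (hV : V ≠ ⊥) :
    ∃ (u : Fin m → ℤ) (i : Fin m), toRat m u ∈ V ∧ ¬ (p : ℤ) ∣ u i := by
  obtain ⟨x, hx, hx0⟩ := V.exists_mem_ne_zero_of_ne_bot hV
  have hne : ∃ h : ℕ, ∃ u : Fin m → ℤ, toRat m u ∈ V ∧ u ≠ 0 ∧ ∑ i, (u i).natAbs = h := by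
    obtain ⟨c, z, hc, hz⟩ := exists_smul_eq_toRat x
    refine ⟨_, z, by rw [hz]; exact V.smul_mem _ hx, ?_, rfl⟩
    rintro rfl
    rw [map_zero] at hz
    exact (smul_ne_zero (by exact_mod_cast hc) hx0) hz.symm
  classical
  obtain ⟨u, hu, hu0, huh⟩ := Nat.find_spec hne
  by_contra! hcon
  choose w hw using fun i => hcon u i hu
  have hp := (Fact.out : p.Prime)
  have huw : u = (p : ℤ) • w := by
    ext i
    rw [hw i]
    rfl
  have hw0 : w ≠ 0 := by
    rintro rfl
    exact hu0 (by rw [huw, smul_zero])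
  have hwV : toRat m w ∈ V := by
    rw [huw, map_zsmul] at hu
    have := V.smul_mem ((p : ℚ)⁻¹) hu
    rwa [← Int.cast_smul_eq_zsmul ℚ, smul_smul, Int.cast_natCast, inv_mul_cancel₀
      (by exact_mod_cast hp.ne_zero), one_smul] at this
  obtain ⟨i, hi⟩ := Function.ne_iff.1 hw0
  refine Nat.find_min hne (m := ∑ i, (w i).natAbs) ?_ ⟨w, hwV, hw0, rfl⟩
  rw [← huh]
  have habs : ∀ j, (u j).natAbs = p * (w j).natAbs := fun j => by
    rw [hw j, Int.natAbs_mul, Int.natAbs_natCast]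
  refine Finset.sum_lt_sum (fun j _ => ?_) ⟨i, Finset.mem_univ i, ?_⟩
  · rw [habs]
    exact Nat.le_mul_of_pos_left _ hp.pos
  · rw [habs]
    have : 0 < (w i).natAbs := Int.natAbs_pos.2 hi
    have := hp.two_le
    nlinarith

theorem exists_not_dvd_minor {V : Submodule ℚ (Fin m → ℚ)} (hV : 2 ≤ finrank ℚ V) :
    ∃ (u v : Fin m → ℤ) (i j : Fin m), toRat m u ∈ V ∧ toRat m v ∈ V ∧
      ¬ (p : ℤ) ∣ u i * v j - u j * v i := by
  have hVne : V ≠ ⊥ := by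
    rintro rfl
    rw [finrank_bot] at hV
    omega
  obtain ⟨u, i, hu, hui⟩ := exists_not_dvd_coord (p := p) hVne
  have hV' : V ⊓ LinearMap.ker (LinearMap.proj i : (Fin m → ℚ) →ₗ[ℚ] ℚ) ≠ ⊥ := by
    intro h
    have hinj : Function.Injective
        ((LinearMap.proj i : (Fin m → ℚ) →ₗ[ℚ] ℚ).domRestrict V) := by
      rw [← LinearMap.ker_eq_bot, LinearMap.ker_eq_bot']
      intro x hx
      have : (x : Fin m → ℚ) ∈ V ⊓ LinearMap.ker (LinearMap.proj i : (Fin m → ℚ) →ₗ[ℚ] ℚ) :=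
        ⟨x.2, hx⟩
      rw [h] at this
      exact Subtype.ext (by simpa using this)
    have := LinearMap.finrank_le_finrank_of_injective hinj
    rw [finrank_self] at this
    omega
  obtain ⟨v, j, hv, hvj⟩ := exists_not_dvd_coord (p := p) hV'
  refine ⟨u, v, i, j, hu, hv.1, ?_⟩
  have hvi : v i = 0 := by
    have : ((v i : ℤ) : ℚ) = 0 := hv.2
    exact_mod_cast this
  rw [hvi, mul_zero, sub_zero]
  intro h
  rcases (Nat.prime_iff_prime_int.1 (Fact.out : p.Prime)).dvd_or_dvd h with h | h
  · exact hui h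
  · exact hvj h

theorem coeff_mul_eq_of_wronskian_eq_zero {K : Type*} [Field K] [CharZero K] {f g : K[X]}
    (h : wronskian f g = 0) (i j : ℕ) : f.coeff i * g.coeff j = f.coeff j * g.coeff i := by
  classical
  by_cases hf : f = 0
  · simp [hf]
  have hd : EuclideanDomain.gcd f g ≠ 0 := fun h0 => hf (EuclideanDomain.gcd_eq_zero_iff.1 h0).1
  obtain ⟨f', hf'⟩ := EuclideanDomain.gcd_dvd_left f g
  obtain ⟨g', hg'⟩ := EuclideanDomain.gcd_dvd_right f g
  have hcop : IsCoprime f' g' := by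
    have := EuclideanDomain.gcd_eq_gcd_ab f g
    refine ⟨EuclideanDomain.gcdA f g, EuclideanDomain.gcdB f g, ?_⟩
    apply mul_left_cancel₀ hd
    linear_combination -this - EuclideanDomain.gcdA f g * hf' - EuclideanDomain.gcdB f g * hg'
  set d := EuclideanDomain.gcd f g with hdd
  have hW : wronskian f' g' = 0 := by
    have : d * d * wronskian f' g' = 0 := by
      rw [← h, wronskian, wronskian, hf', hg', derivative_mul, derivative_mul]
      ring
    simpa [hd] using this
  obtain ⟨h1, h2⟩ := hcop.wronskian_eq_zero_iff.1 hW
  rw [hf', hg', eq_C_of_derivative_eq_zero h1, eq_C_of_derivative_eq_zero h2]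
  simp only [coeff_mul_C]
  ring

theorem IsCompact.exists_pos_forall_le {X : Type*} [TopologicalSpace X] {K : Set X}
    (hK : IsCompact K) {F : X → ℝ} (hF : Continuous F) (h : ∀ x ∈ K, 0 < F x) :
    ∃ c > 0, ∀ x ∈ K, c ≤ F x := by
  rcases K.eq_empty_or_nonempty with rfl | hne
  · exact ⟨1, one_pos, by simp⟩
  · obtain ⟨x, hx, hmin⟩ := hK.exists_isMinOn hne hF.continuousOn
    exact ⟨F x, h x hx, fun y hy => hmin hy⟩

/-- Evaluation of the polynomial with given `p`-adic coefficients. -/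
noncomputable def padicEval (x : ℕ) (z : Fin m → ℤ_[p]) : ℚ_[p] :=
  ∑ i : Fin m, (z i : ℚ_[p]) * (x : ℚ_[p]) ^ (i : ℕ)

/-- Evaluation of the derivative of the polynomial with given `p`-adic coefficients. -/
noncomputable def padicDeriv (x : ℕ) (z : Fin m → ℤ_[p]) : ℚ_[p] :=
  ∑ i : Fin m, (z i : ℚ_[p]) * ((i : ℕ) * (x : ℚ_[p]) ^ ((i : ℕ) - 1))

theorem continuous_padicEval (x : ℕ) : Continuous (padicEval x : (Fin m → ℤ_[p]) → ℚ_[p]) := by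
  unfold padicEval
  fun_prop

theorem continuous_padicDeriv (x : ℕ) : Continuous (padicDeriv x : (Fin m → ℤ_[p]) → ℚ_[p]) := by
  unfold padicDeriv
  fun_prop

/-- The polynomial with given `p`-adic coefficients. -/
noncomputable def padicPoly (z : Fin m → ℤ_[p]) : ℚ_[p][X] :=
  ∑ i : Fin m, monomial (i : ℕ) (z i : ℚ_[p])

theorem coeff_padicPoly (z : Fin m → ℤ_[p]) (i : Fin m) : (padicPoly z).coeff i = z i := by
  rw [padicPoly, finsetSum_coeff, Finset.sum_eq_single i]
  · simp
  · intro j _ hj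
    rw [coeff_monomial, if_neg (fun h => hj (Fin.ext h))]
  · simp

theorem natDegree_padicPoly_le (z : Fin m → ℤ_[p]) : (padicPoly z).natDegree ≤ m - 1 := by
  rw [natDegree_le_iff_coeff_eq_zero]
  intro i hi
  rw [padicPoly, finsetSum_coeff]
  refine Finset.sum_eq_zero fun j _ => ?_
  rw [coeff_monomial, if_neg (by omega)]

theorem eval_padicPoly (x : ℕ) (z : Fin m → ℤ_[p]) :
    (padicPoly z).eval (x : ℚ_[p]) = padicEval x z := by
  simp [padicPoly, padicEval, eval_finsetSum]

theorem eval_derivative_padicPoly (x : ℕ) (z : Fin m → ℤ_[p]) :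
    (derivative (padicPoly z)).eval (x : ℚ_[p]) = padicDeriv x z := by
  simp [padicPoly, padicDeriv, eval_finsetSum, derivative_monomial, mul_assoc]

theorem evalHom_eq_padicEval (x : ℕ) (z : Fin m → ℤ) :
    evalHom p m x z = padicEval x fun i => ((z i : ℤ) : ℤ_[p]) := by
  simp [evalHom_apply, intPoly_apply, padicEval, aeval_monomial]

theorem derivHom_eq_padicDeriv (x : ℕ) (z : Fin m → ℤ) :
    derivHom p m x z = padicDeriv x fun i => ((z i : ℤ) : ℤ_[p]) := by
  simp [derivHom_apply, intPoly_apply, padicDeriv, derivative_monomial, aeval_monomial, mul_assoc]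

theorem eq_zero_of_eval_natCast_eq_zero {f : ℚ_[p][X]} {d : ℕ} (hd : f.natDegree ≤ d) {x : ℕ → ℕ}
    (hx : Function.Injective x) (h : ∀ t ∈ Finset.range (d + 1), f.eval ((x t : ℕ) : ℚ_[p]) = 0) :
    f = 0 := by
  classical
  refine eq_zero_of_natDegree_lt_card_of_eval_eq_zero' f
    ((Finset.range (d + 1)).image fun t => ((x t : ℕ) : ℚ_[p])) ?_ ?_
  · simpa using h
  · have hinj : Function.Injective fun t => ((x t : ℕ) : ℚ_[p]) := Nat.cast_injective.comp hx
    rw [Finset.card_image_of_injective _ hinj, Finset.card_range]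
    omega

theorem exists_le_norm_evalHom {x : ℕ → ℕ} (hx : Function.Injective x) :
    ∃ c > 0, ∀ V : Submodule ℚ (Fin m → ℚ), V ≠ ⊥ → ∃ t ≤ 2 * m, ∃ u, toRat m u ∈ V ∧
      c ≤ ‖evalHom p m (x t) u‖ := by
  have hK : IsCompact {z : Fin m → ℤ_[p] | ∃ i, ‖z i‖ = 1} := by
    apply IsClosed.isCompact
    rw [Set.ofPred_exists]
    exact isClosed_iUnion_of_finite fun i => isClosed_eq (by fun_prop) continuous_const
  obtain ⟨c, hc, h⟩ := hK.exists_pos_forall_le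
    (F := fun z => ∑ t ∈ Finset.range (2 * m + 1), ‖padicEval (x t) z‖)
    (continuous_finsetSum _ fun t _ => (continuous_padicEval (x t)).norm) (by
      rintro z ⟨i, hi⟩
      refine lt_of_le_of_ne (Finset.sum_nonneg fun _ _ => norm_nonneg _) fun h0 => ?_
      rw [eq_comm, Finset.sum_eq_zero_iff_of_nonneg fun _ _ => norm_nonneg _] at h0
      have hf : padicPoly z = 0 := eq_zero_of_eval_natCast_eq_zero (d := 2 * m)
        ((natDegree_padicPoly_le z).trans (by omega)) hx fun t ht => by
          rw [eval_padicPoly, ← norm_eq_zero]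
          exact h0 t ht
      have := coeff_padicPoly z i
      rw [hf, coeff_zero] at this
      have h1 : z i = 0 := Subtype.ext this.symm
      rw [h1, norm_zero] at hi
      exact zero_ne_one hi)
  refine ⟨c / (2 * m + 1 : ℕ), by positivity, fun V hV => ?_⟩
  obtain ⟨u, i, hu, hui⟩ := exists_not_dvd_coord (p := p) hV
  have h1 := h (fun i => ((u i : ℤ) : ℤ_[p])) ⟨i, by
    refine le_antisymm (PadicInt.norm_le_one _) (not_lt.1 fun hlt => hui ?_)
    exact PadicInt.norm_intCast_lt_one_iff.1 hlt⟩
  by_contra! hcon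
  have h2 : ∑ t ∈ Finset.range (2 * m + 1), ‖padicEval (x t) fun i => ((u i : ℤ) : ℤ_[p])‖ <
      ∑ t ∈ Finset.range (2 * m + 1), c / (2 * m + 1 : ℕ) := by
    refine Finset.sum_lt_sum_of_nonempty (by simp) fun t ht => ?_
    rw [← evalHom_eq_padicEval]
    exact hcon t (by rw [Finset.mem_range] at ht; omega) u hu
  rw [Finset.sum_const, Finset.card_range, nsmul_eq_mul, mul_div_cancel₀ _ (by positivity)] at h2
  linarith

theorem exists_le_norm_wronskian {x : ℕ → ℕ} (hx : Function.Injective x) :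
    ∃ c > 0, ∀ V : Submodule ℚ (Fin m → ℚ), 2 ≤ finrank ℚ V → ∃ t ≤ 2 * m, ∃ u v,
      toRat m u ∈ V ∧ toRat m v ∈ V ∧ c ≤ ‖evalHom p m (x t) u * derivHom p m (x t) v -
        derivHom p m (x t) u * evalHom p m (x t) v‖ := by
  have hK : IsCompact {z : (Fin m → ℤ_[p]) × (Fin m → ℤ_[p]) |
      ∃ i j, ‖z.1 i * z.2 j - z.1 j * z.2 i‖ = 1} := by
    apply IsClosed.isCompact
    simp only [Set.ofPred_exists]
    exact isClosed_iUnion_of_finite fun i => isClosed_iUnion_of_finite fun j =>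
      isClosed_eq (by fun_prop) continuous_const
  obtain ⟨c, hc, h⟩ := hK.exists_pos_forall_le
    (F := fun z => ∑ t ∈ Finset.range (2 * m + 1), ‖padicEval (x t) z.1 * padicDeriv (x t) z.2 -
      padicDeriv (x t) z.1 * padicEval (x t) z.2‖)
    (continuous_finsetSum _ fun t _ =>
      ((((continuous_padicEval (x t)).comp continuous_fst).mul
        ((continuous_padicDeriv (x t)).comp continuous_snd)).sub
      (((continuous_padicDeriv (x t)).comp continuous_fst).mul
        ((continuous_padicEval (x t)).comp continuous_snd))).norm) (by
      rintro ⟨y, z⟩ ⟨i, j, hij⟩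
      refine lt_of_le_of_ne (Finset.sum_nonneg fun _ _ => norm_nonneg _) fun h0 => ?_
      rw [eq_comm, Finset.sum_eq_zero_iff_of_nonneg fun _ _ => norm_nonneg _] at h0
      have hdeg : (wronskian (padicPoly y) (padicPoly z)).natDegree ≤ 2 * m := by
        have hy := natDegree_padicPoly_le y
        have hz := natDegree_padicPoly_le z
        have hy' := natDegree_derivative_le (padicPoly y)
        have hz' := natDegree_derivative_le (padicPoly z)
        rw [wronskian]
        refine (natDegree_sub_le _ _).trans (max_le ?_ ?_)
        · refine natDegree_mul_le.trans ?_
          omega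
        · refine natDegree_mul_le.trans ?_
          omega
      have hf := eq_zero_of_eval_natCast_eq_zero hdeg hx fun t ht => by
          rw [wronskian, eval_sub, eval_mul, eval_mul, eval_padicPoly, eval_padicPoly,
            eval_derivative_padicPoly, eval_derivative_padicPoly, ← norm_eq_zero]
          exact h0 t ht
      have := coeff_mul_eq_of_wronskian_eq_zero hf i j
      simp only [coeff_padicPoly] at this
      have h1 : y i * z j - y j * z i = 0 := by
        rw [sub_eq_zero]
        exact Subtype.ext this
      simp only [h1, norm_zero] at hij
      exact zero_ne_one hij)
  refine ⟨c / (2 * m + 1 : ℕ), by positivity, fun V hV => ?_⟩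
  obtain ⟨u, v, i, j, hu, hv, huv⟩ := exists_not_dvd_minor (p := p) hV
  have h1 := h (fun i => ((u i : ℤ) : ℤ_[p]), fun i => ((v i : ℤ) : ℤ_[p])) ⟨i, j, by
    refine le_antisymm (PadicInt.norm_le_one _) (not_lt.1 fun hlt => huv ?_)
    refine PadicInt.norm_intCast_lt_one_iff.1 ?_
    push_cast
    exact hlt⟩
  by_contra! hcon
  have h2 := Finset.sum_lt_sum_of_nonempty (s := Finset.range (2 * m + 1)) (by simp) fun t ht =>
    hcon t (by rw [Finset.mem_range] at ht; omega) u v hu hv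
  simp only [← evalHom_eq_padicEval, ← derivHom_eq_padicDeriv] at h1
  rw [Finset.sum_const, Finset.card_range, nsmul_eq_mul, mul_div_cancel₀ _ (by positivity)] at h2
  linarith

end LowerBound

section ManyFlags

open Module

variable {p : ℕ} [Fact p.Prime] {m : ℕ}

theorem intPoly_single (i : Fin m) (c : ℤ) : intPoly m (Pi.single i c) = monomial (i : ℕ) c := by
  rw [intPoly_apply, Finset.sum_eq_single i]
  · simp
  · intro j _ hj
    rw [Pi.single_eq_of_ne hj, monomial_zero_right]
  · simp

theorem one_lt_polySize {a b : ℕ} {Q : ℝ} (hQ : 0 < Q) {V : Submodule ℚ (Fin m → ℚ)} {x : ℕ}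
    {u v : Fin m → ℤ} (hu : toRat m u ∈ V) (hv : toRat m v ∈ V)
    (h : Q ^ finrank ℚ V < localSize a b (evalHom p m x) (derivHom p m x) u v) :
    1 < polySize p m a b Q V x := by
  have h1 := localSize_le_localSup (a := a) (b := b) (norm_evalHom_le (p := p) x)
    (norm_derivHom_le x) hu hv
  have h2 : (1 : ℝ) ≤ covol V := by exact_mod_cast one_le_covol V
  have h3 := one_le_localSup (a := a) (b := b) (norm_evalHom_le (p := p) x)
    (norm_derivHom_le x) V
  rw [polySize, subspaceSize, one_lt_div (by positivity)]
  have h4 : localSup a b (evalHom p m x) (derivHom p m x) V ≤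
      covol V * localSup a b (evalHom p m x) (derivHom p m x) V :=
    le_mul_of_one_le_left (by linarith) h2
  linarith

theorem exists_one_lt_polySize (hm : 2 ≤ m) {x : ℕ → ℕ} (hx : Function.Injective x) :
    ∃ c : ℝ, 0 < c ∧ ∀ (a b : ℕ) (Q : ℝ), 1 ≤ Q → Q < (p : ℝ) ^ a * c →
      Q ^ (m - 1) < (p : ℝ) ^ (a + b) * c → Q ^ m < (p : ℝ) ^ (a + b) →
      ∀ V : Submodule ℚ (Fin m → ℚ), V ≠ ⊥ → ∃ t ≤ 2 * m, 1 < polySize p m a b Q V (x t) := by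
  obtain ⟨c₁, hc₁, h₁⟩ := exists_le_norm_evalHom (p := p) (m := m) hx
  obtain ⟨c₂, hc₂, h₂⟩ := exists_le_norm_wronskian (p := p) (m := m) hx
  have hp := one_le_cast_prime (p := p)
  refine ⟨min c₁ c₂, lt_min hc₁ hc₂, fun a b Q hQ1 hQa hQab hQm V hV => ?_⟩
  have hQ0 : 0 < Q := by linarith
  have hle : finrank ℚ V ≤ m := by simpa using Submodule.finrank_le V
  have hpos : 0 < finrank ℚ V := Nat.pos_of_ne_zero fun h => hV (Submodule.finrank_eq_zero.1 h)
  rcases Nat.lt_or_ge (finrank ℚ V) 2 with h2 | h2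
  · obtain ⟨t, ht, u, hu, hcu⟩ := h₁ V hV
    refine ⟨t, ht, one_lt_polySize hQ0 hu hu ?_⟩
    have hk : finrank ℚ V = 1 := by omega
    rw [hk, pow_one]
    refine lt_of_lt_of_le ?_ ((le_max_right _ _).trans (le_max_left _ _))
    refine hQa.trans_le (mul_le_mul_of_nonneg_left ((min_le_left _ _).trans hcu) (by positivity))
  · rcases Nat.lt_or_ge (finrank ℚ V) m with h3 | h3
    · obtain ⟨t, ht, u, v, hu, hv, hcuv⟩ := h₂ V h2
      refine ⟨t, ht, one_lt_polySize hQ0 hu hv ?_⟩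
      refine lt_of_lt_of_le ?_ ((le_max_right _ _).trans (le_max_right _ _))
      refine (pow_le_pow_right₀ hQ1 (by omega : finrank ℚ V ≤ m - 1)).trans_lt ?_
      exact hQab.trans_le (mul_le_mul_of_nonneg_left ((min_le_right _ _).trans hcuv)
        (by positivity))
    · have hk : finrank ℚ V = m := le_antisymm hle h3
      have htop : V = ⊤ := Submodule.eq_top_of_finrank_eq (by rw [hk]; simp)
      have hmem : ∀ z, toRat m z ∈ V := fun z => by rw [htop]; trivial
      refine ⟨0, by omega, one_lt_polySize hQ0 (hmem (Pi.single ⟨0, by omega⟩ 1))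
        (hmem (Pi.single ⟨1, by omega⟩ 1)) ?_⟩
      rw [hk]
      refine lt_of_lt_of_le ?_ ((le_max_right _ _).trans (le_max_right _ _))
      simpa [evalHom_apply, derivHom_apply, intPoly_single, aeval_monomial,
        derivative_monomial] using hQm

theorem card_le_of_isChain {C : Finset (Submodule ℚ (Fin m → ℚ))}
    (hC : (C : Set (Submodule ℚ (Fin m → ℚ))) ⊆ {V | V ≠ ⊥})
    (h : IsChain (· ≤ ·) (C : Set (Submodule ℚ (Fin m → ℚ)))) : C.card ≤ m := by
  have hinj : Set.InjOn (fun V : Submodule ℚ (Fin m → ℚ) => finrank ℚ V) C := by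
    intro U hU V hV hUV
    by_contra hne
    rcases h hU hV hne with h | h
    · exact hne (Submodule.eq_of_le_of_finrank_eq h hUV)
    · exact hne (Submodule.eq_of_le_of_finrank_eq h hUV.symm).symm
  have hmaps : ∀ V ∈ C, finrank ℚ V ∈ Finset.Icc 1 m := by
    intro V hV
    rw [Finset.mem_Icc]
    exact ⟨Nat.pos_of_ne_zero fun h => hC hV (Submodule.finrank_eq_zero.1 h),
      by simpa using Submodule.finrank_le V⟩
  have := Finset.card_le_card_of_injOn _ hmaps hinj
  simpa using this

open Classical in
/-- In every ball, at least half of the residues have a good flag. -/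
theorem exists_half_le_card_hasFlag (p m : ℕ) [Fact p.Prime] (hm : 2 ≤ m) :
    ∃ (l : ℕ) (σ : ℝ), 0 < σ ∧ σ ≤ 1 ∧ ∀ x₀ s : ℕ, x₀ < p ^ s → ∃ c : ℝ, 0 < c ∧
      ∀ (a b N : ℕ) (Q : ℝ), 1 ≤ Q → Q < (p : ℝ) ^ a * c →
      Q ^ (m - 1) < (p : ℝ) ^ (a + b) * c → Q ^ m < (p : ℝ) ^ (a + b) →
      a + b + l ≤ N → s ≤ N → (2 * m + 1) * p ^ s ≤ p ^ N →
      ((p ^ (N - s) : ℕ) : ℝ) ≤ 2 * ((Finset.univ.filter fun z : Fin (p ^ N) =>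
        (z : ℕ) ≡ x₀ [MOD p ^ s] ∧ HasFlag (fun (V : Submodule ℚ (Fin m → ℚ)) (z : Fin (p ^ N)) =>
          polySize p m a b Q V z) {V | V ≠ ⊥} 1 σ z).card : ℝ) := by
  have hp := (Fact.out : p.Prime)
  have hp1 : (1 : ℝ) < p := by exact_mod_cast hp.one_lt
  obtain ⟨l, hl⟩ := pow_unbounded_of_one_lt (2 * (m * p ^ m * (2 * m : ℕ)) : ℝ) hp1
  have hpl : (0 : ℝ) < (p : ℝ) ^ (l * (2 * m)) := by positivity
  refine ⟨l, ((p : ℝ) ^ (l * (2 * m)))⁻¹, by positivity, inv_le_one_of_one_le₀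
    (one_le_pow₀ hp1.le), fun x₀ s hx₀ => ?_⟩
  have hx : Function.Injective fun t => x₀ + p ^ s * t := by
    intro t t' h
    exact Nat.eq_of_mul_eq_mul_left (pow_pos hp.pos s) (Nat.add_left_cancel h)
  obtain ⟨c, hc, h⟩ := exists_one_lt_polySize (p := p) hm hx
  refine ⟨c, hc, fun a b N Q hQ1 hQa hQab hQm hN hsN hmN => ?_⟩
  set σ := ((p : ℝ) ^ (l * (2 * m)))⁻¹ with hσ
  have hσ1 : σ ≤ 1 := inv_le_one_of_one_le₀ (one_le_pow₀ hp1.le)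
  have hx₀N : x₀ < p ^ N := hx₀.trans_le (Nat.pow_le_pow_right hp.pos hsN)
  let x : Fin (p ^ N) := ⟨x₀, hx₀N⟩
  set ψ : Submodule ℚ (Fin m → ℚ) → Fin (p ^ N) → ℝ := fun V z => polySize p m a b Q V z with hψ
  have key := card_not_hasFlag_le (resBall p N) N p hp.one_lt.le mem_resBall_self
    resBall_eq_of_mem resBall_anti (fun x j => card_resBall_le_mul x j hp.pos)
    (fun x => resBall_eq_singleton x N hp.pos le_rfl) ψ 1 σ ((2 * m : ℕ) / (p : ℝ) ^ l)
    hσ1 (by positivity)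
    (fun V x j hV => card_filter_polySize_le hN (by linarith) (by positivity) hσ1
      (mul_inv_cancel₀ hpl.ne').le V x j hV)
    m {V | V ≠ ⊥} (fun C hC hCh => card_le_of_isChain hC hCh) x s hsN (fun W hW => by
      obtain ⟨t, ht, hlt⟩ := h a b Q hQ1 hQa hQab hQm W hW
      have hlt' : x₀ + p ^ s * t < p ^ N := by
        calc x₀ + p ^ s * t < p ^ s + p ^ s * (2 * m) :=
              Nat.add_lt_add_of_lt_of_le hx₀ (Nat.mul_le_mul_left _ ht)
          _ = (2 * m + 1) * p ^ s := by ring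
          _ ≤ p ^ N := hmN
      refine ⟨⟨x₀ + p ^ s * t, hlt'⟩, mem_resBall.2 ?_, hlt⟩
      change x₀ + p ^ s * t ≡ x₀ [MOD p ^ s]
      simp [Nat.ModEq])
  have hcard := card_resBall x s hp.pos hsN
  rw [hcard] at key
  have hη : (m * p ^ m * ((2 * m : ℕ) / (p : ℝ) ^ l) : ℝ) ≤ 1 / 2 := by
    rw [← mul_div_assoc, div_le_iff₀ (by positivity)]
    linarith
  have h1 : (((resBall p N x s).filter fun z => ¬ HasFlag ψ {V | V ≠ ⊥} 1 σ z).card : ℝ) ≤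
      1 / 2 * ((p ^ (N - s) : ℕ) : ℝ) :=
    key.trans (mul_le_mul_of_nonneg_right hη (Nat.cast_nonneg _))
  have h2 := Finset.card_filter_add_card_filter_not (s := resBall p N x s)
    fun z => HasFlag ψ {V | V ≠ ⊥} 1 σ z
  rw [hcard] at h2
  have h3 : (Finset.univ.filter fun z : Fin (p ^ N) =>
      (z : ℕ) ≡ x₀ [MOD p ^ s] ∧ HasFlag ψ {V | V ≠ ⊥} 1 σ z) =
      (resBall p N x s).filter fun z => HasFlag ψ {V | V ≠ ⊥} 1 σ z := by
    ext z
    rw [Finset.mem_filter, Finset.mem_filter, mem_resBall]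
    simp [x]
  rw [h3]
  have h4 : (((resBall p N x s).filter fun z => HasFlag ψ {V | V ≠ ⊥} 1 σ z).card : ℝ) +
      ((resBall p N x s).filter fun z => ¬ HasFlag ψ {V | V ≠ ⊥} 1 σ z).card =
        ((p ^ (N - s) : ℕ) : ℝ) := by exact_mod_cast h2
  linarith

end ManyFlags

section Construction

theorem natAbs_sub_mul_lt {J r e f : ℕ} {z h : ℤ} {k k' : ℤ} (hJ : f < e) (heJ : e < J)
    (hh : (J * (r + 1) : ℤ) ≤ h) (hz : |z| ≤ h) (hk : |k - k'| ≤ r) :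
    |z - ((z * e / J + k) - (z * f / J + k'))| < h := by
  have hJ0 : (0 : ℤ) < J := by omega
  have h1 := Int.mul_ediv_add_emod (z * e) J
  have h2 := Int.mul_ediv_add_emod (z * f) J
  have h3 := Int.emod_nonneg (z * e) hJ0.ne'
  have h4 := Int.emod_lt_of_pos (z * e) hJ0
  have h5 := Int.emod_nonneg (z * f) hJ0.ne'
  have h6 := Int.emod_lt_of_pos (z * f) hJ0
  set A := z * e / J
  set B := z * f / J
  rw [abs_le] at hz hk
  obtain ⟨d, rfl⟩ : ∃ d : ℕ, e = f + d + 1 := ⟨e - f - 1, by omega⟩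
  obtain ⟨g, rfl⟩ : ∃ g : ℕ, J = f + d + 1 + g + 1 := ⟨J - (f + d + 1) - 1, by omega⟩
  push_cast at *
  set J : ℤ := (f + d + 1 + g + 1 : ℤ) with hJdef
  have hg : (0 : ℤ) ≤ f + g + 1 := by positivity
  have h7 : J * (z - (A + k - (B + k'))) ≤ z * (f + g + 1) + (J - 1) + J * r := by
    have : J * (k' - k) ≤ J * r := mul_le_mul_of_nonneg_left (by linarith) hJ0.le
    rw [hJdef] at *
    linarith
  have h8 : z * (f + g + 1) - (J - 1) - J * r ≤ J * (z - (A + k - (B + k'))) := by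
    have : J * (k - k') ≤ J * r := mul_le_mul_of_nonneg_left (by linarith) hJ0.le
    rw [hJdef] at *
    linarith
  have h9 : z * (f + g + 1) ≤ h * (f + g + 1) := mul_le_mul_of_nonneg_right hz.2 hg
  have h10 : -h * (f + g + 1) ≤ z * (f + g + 1) := mul_le_mul_of_nonneg_right hz.1 hg
  have h0 : 0 ≤ h := by linarith
  have h11 : 0 ≤ h * d := by positivity
  have h12 : J * h = h * (f + g + 1) + h * d + h := by rw [hJdef]; ring
  rw [abs_lt]
  constructor
  · refine lt_of_mul_lt_mul_left ?_ hJ0.le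
    linarith
  · refine lt_of_mul_lt_mul_left ?_ hJ0.le
    linarith

/-- If the kernel of a homomorphism to a finite group has no short nonzero vectors, then every
fibre contains a short vector. -/
theorem exists_vecHeight_le_of_ker {m r J : ℕ} {T : Type*} [AddCommGroup T] [Fintype T]
    (φ : (Fin m → ℤ) →+ T) (hker : ∀ v, φ v = 0 → v ≠ 0 → r < vecHeight v)
    (hJ : Fintype.card T < J * (r + 1) ^ m) (z₀ : Fin m → ℤ) :
    ∃ z, φ z = φ z₀ ∧ vecHeight z ≤ J * (r + 1) := by
  classical
  have hne : ∃ h : ℕ, ∃ z, φ z = φ z₀ ∧ vecHeight z = h := ⟨_, z₀, rfl, rfl⟩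
  obtain ⟨z, hz, hzh⟩ := Nat.find_spec hne
  refine ⟨z, hz, ?_⟩
  by_contra! hlt
  let F : Fin J × (Fin m → Fin (r + 1)) → Fin m → ℤ := fun q i =>
    z i * ((q.1 : ℕ) : ℤ) / (J : ℤ) + ((q.2 i : ℕ) : ℤ)
  obtain ⟨q, q', hqq, hF⟩ := Fintype.exists_ne_map_eq_of_card_lt (fun q => φ (F q)) (by
    simpa [Fintype.card_prod] using hJ)
  have habs : ∀ k k' : Fin (r + 1), |((k : ℕ) : ℤ) - ((k' : ℕ) : ℤ)| ≤ r := by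
    intro k k'
    rw [abs_le]
    omega
  have hgt : ∀ q q' : Fin J × (Fin m → Fin (r + 1)), φ (F q) = φ (F q') → ¬ q'.1 < q.1 := by
    intro q q' hF hlt'
    refine Nat.find_min hne (m := vecHeight (z - (F q - F q'))) ?_
      ⟨_, by rw [map_sub, map_sub, hF, sub_self, sub_zero, hz], rfl⟩
    rw [← hzh]
    refine (Finset.sup_lt_iff (bot_le.trans_lt hlt)).2 fun i _ => ?_
    have h := natAbs_sub_mul_lt (J := J) (r := r) (z := z i) (h := vecHeight z)
      (k := (q.2 i : ℕ)) (k' := (q'.2 i : ℕ)) hlt' q.1.2 (by exact_mod_cast hlt.le)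
      (by rw [Int.abs_eq_natAbs]; exact_mod_cast natAbs_le_vecHeight z i) (habs _ _)
    rw [Int.abs_eq_natAbs] at h
    exact_mod_cast h
  rcases lt_trichotomy q.1 q'.1 with h | h | h
  · exact hgt q' q hF.symm h
  · have hd : φ (F q - F q') = 0 := by rw [map_sub, sub_eq_zero]; exact hF
    have hFi : ∀ i, (F q - F q') i = ((q.2 i : ℕ) : ℤ) - ((q'.2 i : ℕ) : ℤ) := by
      intro i
      change z i * ((q.1 : ℕ) : ℤ) / (J : ℤ) + ((q.2 i : ℕ) : ℤ) -
        (z i * ((q'.1 : ℕ) : ℤ) / (J : ℤ) + ((q'.2 i : ℕ) : ℤ)) = _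
      rw [h]
      ring
    have hne0 : F q - F q' ≠ 0 := by
      intro h0
      refine hqq (Prod.ext h (funext fun i => Fin.ext ?_))
      have := hFi i
      rw [h0, Pi.zero_apply] at this
      omega
    have := hker _ hd hne0
    refine absurd this (not_lt.2 (Finset.sup_le fun i _ => ?_))
    have h1 := habs (q.2 i) (q'.2 i)
    rw [← hFi, Int.abs_eq_natAbs] at h1
    exact_mod_cast h1
  · exact hgt q q' hF h

theorem natAbs_coeff_le_polyHeight (P : ℤ[X]) (i : ℕ) : (P.coeff i).natAbs ≤ polyHeight P := by
  by_cases hi : i ≤ P.natDegree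
  · exact Finset.le_sup (f := fun i => (P.coeff i).natAbs) (Finset.mem_range.2 (by omega))
  · rw [coeff_eq_zero_of_natDegree_lt (by omega)]
    exact Nat.zero_le _

theorem exists_intPoly_eq {m : ℕ} {P : ℤ[X]} (hP : P.natDegree < m) :
    ∃ v, intPoly m v = P ∧ vecHeight v ≤ polyHeight P := by
  refine ⟨fun i => P.coeff i, ?_, Finset.sup_le fun i _ => natAbs_coeff_le_polyHeight P i⟩
  ext i
  by_cases hi : i < m
  · exact coeff_intPoly (fun i : Fin m => P.coeff i) ⟨i, hi⟩
  · rw [coeff_intPoly_of_le _ (by omega), coeff_eq_zero_of_natDegree_lt (by omega)]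

theorem natAbs_coeff_intPoly_le {m : ℕ} (v : Fin m → ℤ) (i : ℕ) :
    ((intPoly m v).coeff i).natAbs ≤ vecHeight v := by
  by_cases hi : i < m
  · rw [coeff_intPoly v ⟨i, hi⟩]
    exact natAbs_le_vecHeight v _
  · rw [coeff_intPoly_of_le _ (by omega)]
    exact Nat.zero_le _

/-- An Eisenstein polynomial with prescribed local behaviour at `x`. -/
theorem exists_target_poly {p q : ℕ} (hp : p.Prime) (hq : q.Prime) (hpq : q ≠ p) {n : ℕ}
    (hn : 2 ≤ n) (a b : ℕ) (x : ℤ) : ∃ P : ℤ[X], P.natDegree ≤ n ∧ (p : ℤ) ^ a ∣ P.eval x ∧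
      (p : ℤ) ^ (b + 1) ∣ (derivative P).eval x - p ^ b ∧
      (p : ℤ) ∣ (hasseDeriv 2 P).eval x - 1 ∧
      ∀ i, (q : ℤ) ^ 2 ∣ P.coeff i - (X ^ n + C (q : ℤ)).coeff i := by
  have hcop : IsCoprime ((p : ℤ) ^ (a + b + 1)) ((q : ℤ) ^ 2) :=
    ((Nat.isCoprime_iff_coprime.2 ((Nat.coprime_primes hp hq).2 hpq.symm)).pow)
  obtain ⟨u, v, huv⟩ := hcop
  set P₀ : ℤ[X] := C ((p : ℤ) ^ b) * (X - C x) + (X - C x) ^ 2 with hP₀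
  set E : ℤ[X] := X ^ n + C (q : ℤ) with hE
  have ht : taylor x P₀ = C ((p : ℤ) ^ b) * X + X ^ 2 := by
    rw [hP₀, map_add, taylor_mul, taylor_pow, map_sub, taylor_X, taylor_C, taylor_C,
      add_sub_cancel_right]
  have ht0 : P₀.eval x = 0 := by simp [hP₀]
  have ht1 : (derivative P₀).eval x = p ^ b := by
    rw [← taylor_coeff_one, ht, coeff_add, coeff_C_mul, coeff_X_one, coeff_X_pow,
      if_neg (by decide), mul_one, add_zero]
  have ht2 : (hasseDeriv 2 P₀).eval x = 1 := by
    rw [← taylor_coeff, ht, coeff_add, coeff_C_mul, coeff_X, coeff_X_pow, if_neg (by decide),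
      if_pos rfl, mul_zero, zero_add]
  have hv : v * (q : ℤ) ^ 2 = 1 - u * (p : ℤ) ^ (a + b + 1) := by linarith
  have hpow : ∀ k ≤ a + b + 1, (p : ℤ) ^ k ∣ (p : ℤ) ^ (a + b + 1) := fun k hk => pow_dvd_pow _ hk
  refine ⟨C (v * (q : ℤ) ^ 2) * P₀ + C (u * (p : ℤ) ^ (a + b + 1)) * E, ?_, ?_, ?_, ?_, ?_⟩
  · refine (natDegree_add_le _ _).trans (max_le ?_ ?_)
    · refine (natDegree_C_mul_le _ _).trans ?_
      refine (natDegree_add_le _ _).trans (max_le ?_ ?_)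
      · refine (natDegree_C_mul_le _ _).trans ?_
        rw [natDegree_X_sub_C]
        omega
      · rw [natDegree_pow, natDegree_X_sub_C]
        omega
    · refine (natDegree_C_mul_le _ _).trans ?_
      rw [hE, natDegree_X_pow_add_C]
  · rw [eval_add, eval_C_mul, eval_C_mul, ht0, mul_zero, zero_add, mul_comm u, mul_assoc]
    exact (hpow a (by omega)).mul_right _
  · obtain ⟨w, hw⟩ := hpow (b + 1) (by omega)
    rw [derivative_add, derivative_C_mul, derivative_C_mul, eval_add, eval_C_mul, eval_C_mul, ht1,
      hv, hw]
    exact ⟨u * w * ((derivative E).eval x - p ^ b), by ring⟩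
  · obtain ⟨w, hw⟩ := hpow 1 (by omega)
    rw [map_add, eval_add, ← smul_eq_C_mul, ← smul_eq_C_mul, map_smul, map_smul, eval_smul,
      eval_smul, smul_eq_mul, smul_eq_mul, ht2, hv, hw]
    exact ⟨u * w * ((hasseDeriv 2 E).eval x - 1), by ring⟩
  · intro i
    have hu : u * (p : ℤ) ^ (a + b + 1) = 1 - v * (q : ℤ) ^ 2 := by linarith
    rw [coeff_add, coeff_C_mul, coeff_C_mul, hu]
    exact ⟨v * (P₀.coeff i - E.coeff i), by ring⟩

theorem irreducible_of_coeff_modEq {q n : ℕ} (hq : q.Prime) (hn : 2 ≤ n) {P : ℤ[X]} {c : ℤ}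
    (hP : P.IsPrimitive) (hdeg : P.natDegree ≤ n)
    (h : ∀ i, (q : ℤ) ^ 2 ∣ c * P.coeff i - (X ^ n + C (q : ℤ)).coeff i) :
    Irreducible P ∧ P.natDegree = n := by
  have hq' := Nat.prime_iff_prime_int.1 hq
  have hqq : (q : ℤ) ∣ (q : ℤ) ^ 2 := dvd_pow_self _ two_ne_zero
  have hn0 : n ≠ 0 := by omega
  have hlead : ¬ (q : ℤ) ∣ c * P.coeff n := by
    intro hd
    have := (dvd_sub_right hd).1 (hqq.trans (h n))
    rw [coeff_add, coeff_X_pow_self, coeff_C, if_neg hn0, add_zero] at this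
    exact hq'.not_dvd_one this
  have hc : ¬ (q : ℤ) ∣ c := fun h => hlead (h.mul_right _)
  have hPn : ¬ (q : ℤ) ∣ P.coeff n := fun h => hlead (h.mul_left _)
  have hPn0 : P.coeff n ≠ 0 := fun h => hPn (by rw [h]; exact dvd_zero _)
  have hnat : P.natDegree = n := le_antisymm hdeg (le_natDegree_of_ne_zero hPn0)
  have hdegree : P.degree = n := by
    rw [degree_eq_natDegree (by rintro rfl; exact hPn0 (coeff_zero _)), hnat]
  refine ⟨?_, hnat⟩
  refine irreducible_of_eisenstein_criterion
    ((Ideal.span_singleton_prime hq'.ne_zero).2 hq') ?_ ?_ ?_ ?_ hP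
  · rw [Ideal.mem_span_singleton, leadingCoeff, hnat]
    exact hPn
  · intro i hi
    rw [hdegree] at hi
    have hi' : i < n := by exact_mod_cast hi
    rw [Ideal.mem_span_singleton]
    have h1 := hqq.trans (h i)
    have h2 : (q : ℤ) ∣ (X ^ n + C (q : ℤ)).coeff i := by
      rw [coeff_add, coeff_X_pow, if_neg hi'.ne, zero_add, coeff_C]
      split_ifs
      · exact dvd_rfl
      · exact dvd_zero _
    have h3 := (dvd_sub_left h2).1 h1
    exact (hq'.dvd_or_dvd h3).resolve_left hc
  · rw [hdegree]
    exact_mod_cast Nat.pos_of_ne_zero hn0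
  · rw [Ideal.span_singleton_pow, Ideal.mem_span_singleton]
    intro hd
    have h1 := (dvd_sub_right (hd.mul_left c)).1 (h 0)
    rw [coeff_add, coeff_X_pow, if_neg hn0.symm, zero_add, coeff_C_zero, sq] at h1
    have h2 : (q : ℤ) ∣ 1 :=
      (mul_dvd_mul_iff_left hq'.ne_zero).1 (by rwa [mul_one])
    exact hq'.not_dvd_one h2

theorem exists_irreducible_poly {p q : ℕ} (hp : p.Prime) (hq : q.Prime) (hpq : q ≠ p) {n : ℕ}
    (hn : 2 ≤ n) {a b r J : ℕ} {x : ℤ}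
    (hker : ∀ v : Fin (n + 1) → ℤ, v ≠ 0 → (p : ℤ) ^ a ∣ (intPoly (n + 1) v).eval x →
      (p : ℤ) ^ b ∣ (derivative (intPoly (n + 1) v)).eval x → r < vecHeight v)
    (hJ : p ^ a * (p ^ (b + 1) * (p * (q ^ 2) ^ (n + 1))) < J * (r + 1) ^ (n + 1)) :
    ∃ P : ℤ[X], Irreducible P ∧ P.natDegree = n ∧ r < polyHeight P ∧
      polyHeight P ≤ J * (r + 1) ∧ (p : ℤ) ^ a ∣ P.eval x ∧
      (p : ℤ) ^ b ∣ (derivative P).eval x ∧ ¬ (p : ℤ) ^ (b + 1) ∣ (derivative P).eval x ∧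
      ¬ (p : ℤ) ∣ (hasseDeriv 2 P).eval x := by
  have hp' := Nat.prime_iff_prime_int.1 hp
  have hpos : ∀ k, p ^ k ≠ 0 := fun k => pow_ne_zero _ hp.ne_zero
  have : NeZero (p ^ a) := ⟨hpos _⟩
  have : NeZero (p ^ (b + 1)) := ⟨hpos _⟩
  have : NeZero p := ⟨hp.ne_zero⟩
  have : NeZero (q ^ 2) := ⟨pow_ne_zero _ hq.ne_zero⟩
  let ev : ℤ[X] →+ ℤ := (evalRingHom x).toAddMonoidHom
  let φ : (Fin (n + 1) → ℤ) →+ ZMod (p ^ a) × (ZMod (p ^ (b + 1)) × (ZMod p ×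
      (Fin (n + 1) → ZMod (q ^ 2)))) :=
    ((Int.castAddHom _).comp (ev.comp (intPoly (n + 1)))).prod
      (((Int.castAddHom _).comp (ev.comp ((derivative (R := ℤ)).toAddMonoidHom.comp
        (intPoly (n + 1))))).prod
      (((Int.castAddHom _).comp (ev.comp ((hasseDeriv (R := ℤ) 2).toAddMonoidHom.comp
        (intPoly (n + 1))))).prod ((Int.castAddHom _).compLeft _)))
  have hφ : ∀ y z, φ y = φ z ↔ ((p ^ a : ℕ) : ℤ) ∣ (intPoly (n + 1) z).eval x -
      (intPoly (n + 1) y).eval x ∧ ((p ^ (b + 1) : ℕ) : ℤ) ∣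
      (derivative (intPoly (n + 1) z)).eval x - (derivative (intPoly (n + 1) y)).eval x ∧
      (p : ℤ) ∣ (hasseDeriv 2 (intPoly (n + 1) z)).eval x -
        (hasseDeriv 2 (intPoly (n + 1) y)).eval x ∧
      ∀ i, ((q ^ 2 : ℕ) : ℤ) ∣ z i - y i := by
    intro y z
    rw [Prod.ext_iff, Prod.ext_iff, Prod.ext_iff, funext_iff]
    simp only [← ZMod.intCast_eq_intCast_iff_dvd_sub]
    rfl
  have hJ' : Fintype.card (ZMod (p ^ a) × (ZMod (p ^ (b + 1)) × (ZMod p ×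
      (Fin (n + 1) → ZMod (q ^ 2))))) < J * (r + 1) ^ (n + 1) := by
    simpa [ZMod.card] using hJ
  have hkerφ : ∀ v, φ v = 0 → v ≠ 0 → r < vecHeight v := by
    intro v hv hv0
    have h := (hφ 0 v).1 (by rw [hv, map_zero])
    simp only [map_zero, eval_zero, sub_zero] at h
    refine hker v hv0 (by exact_mod_cast h.1) ?_
    refine dvd_trans (pow_dvd_pow _ (Nat.le_succ b)) (by exact_mod_cast h.2.1)
  obtain ⟨P₀, hP₀deg, h₀, h₁, h₂, h₃⟩ := exists_target_poly hp hq hpq hn a b x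
  obtain ⟨z₀, hz₀, -⟩ := exists_intPoly_eq (Nat.lt_succ_of_le hP₀deg)
  obtain ⟨z, hz, hzh⟩ := exists_vecHeight_le_of_ker φ hkerφ hJ' z₀
  obtain ⟨g₀, g₁, g₂, g₃⟩ := (hφ z z₀).1 hz
  rw [hz₀] at g₀ g₁ g₂
  set P₁ := intPoly (n + 1) z with hP₁
  push_cast at g₀ g₁ g₂ g₃
  have k₀ : (p : ℤ) ^ a ∣ P₁.eval x := (dvd_sub_right h₀).1 g₀
  have k₁ : (p : ℤ) ^ (b + 1) ∣ (derivative P₁).eval x - p ^ b := by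
    have := dvd_sub h₁ g₁
    rwa [show (derivative P₀).eval x - p ^ b - ((derivative P₀).eval x -
      (derivative P₁).eval x) = (derivative P₁).eval x - p ^ b by ring] at this
  have k₂ : (p : ℤ) ∣ (hasseDeriv 2 P₁).eval x - 1 := by
    have := dvd_sub h₂ g₂
    rwa [show (hasseDeriv 2 P₀).eval x - 1 - ((hasseDeriv 2 P₀).eval x -
      (hasseDeriv 2 P₁).eval x) = (hasseDeriv 2 P₁).eval x - 1 by ring] at this
  have k₃ : ∀ i, (q : ℤ) ^ 2 ∣ P₁.coeff i - (X ^ n + C (q : ℤ)).coeff i := by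
    intro i
    by_cases hi : i < n + 1
    · have e1 := coeff_intPoly z ⟨i, hi⟩
      have e2 := coeff_intPoly z₀ ⟨i, hi⟩
      have h := g₃ ⟨i, hi⟩
      rw [← e1, ← e2, hz₀] at h
      obtain ⟨d, hd⟩ := h₃ i
      obtain ⟨d', hd'⟩ := h
      change P₀.coeff i - P₁.coeff i = _ at hd'
      exact ⟨d - d', by linear_combination hd - hd'⟩
    · rw [hP₁, coeff_intPoly_of_le z (by omega), coeff_eq_zero_of_natDegree_lt
        (by rw [natDegree_X_pow_add_C]; omega)]
      simp
  have hcP := P₁.eq_C_content_mul_primPart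
  set c := P₁.content with hc
  set P := P₁.primPart with hP
  have hdegP : P.natDegree ≤ n := by
    rw [hP, natDegree_primPart, hP₁]
    exact natDegree_intPoly_le z
  have hcoef : ∀ i, P₁.coeff i = c * P.coeff i := fun i => by
    conv_lhs => rw [hcP]
    rw [coeff_C_mul]
  obtain ⟨hirr, hnat⟩ := irreducible_of_coeff_modEq hq hn P₁.isPrimitive_primPart hdegP
    fun i => by rw [← hcoef]; exact k₃ i
  have e₀ : P₁.eval x = c * P.eval x := by
    conv_lhs => rw [hcP]
    rw [eval_C_mul]
  have e₁ : (derivative P₁).eval x = c * (derivative P).eval x := by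
    conv_lhs => rw [hcP]
    rw [derivative_C_mul, eval_C_mul]
  have e₂ : (hasseDeriv 2 P₁).eval x = c * (hasseDeriv 2 P).eval x := by
    conv_lhs => rw [hcP]
    rw [← smul_eq_C_mul, map_smul, eval_smul, smul_eq_mul]
  rw [e₀] at k₀
  rw [e₁] at k₁
  rw [e₂] at k₂
  have hpc2 : ¬ (p : ℤ) ∣ c * (hasseDeriv 2 P).eval x := by
    intro h
    exact hp'.not_dvd_one ((dvd_sub_right h).1 k₂)
  have hpc : ¬ (p : ℤ) ∣ c := fun h => hpc2 (h.mul_right _)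
  have hcop : ∀ k, IsCoprime ((p : ℤ) ^ k) c := fun k =>
    ((hp'.coprime_iff_not_dvd).2 hpc).pow_left
  have hc0 : c ≠ 0 := fun h => hpc (by rw [h]; exact dvd_zero _)
  have l₀ : (p : ℤ) ^ a ∣ P.eval x := (hcop a).dvd_of_dvd_mul_left k₀
  have l₁ : (p : ℤ) ^ b ∣ (derivative P).eval x := by
    refine (hcop b).dvd_of_dvd_mul_left ?_
    exact (dvd_sub_left dvd_rfl).1 ((pow_dvd_pow _ (Nat.le_succ b)).trans k₁)
  obtain ⟨v, hv, hvh⟩ := exists_intPoly_eq (Nat.lt_succ_of_le hdegP)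
  refine ⟨P, hirr, hnat, ?_, ?_, l₀, l₁, ?_, fun h => hpc2 (h.mul_left _)⟩
  · refine (hker v ?_ (by rwa [hv]) (by rwa [hv])).trans_le hvh
    rintro rfl
    rw [map_zero] at hv
    exact hirr.ne_zero hv.symm
  · refine (Finset.sup_le fun i _ => ?_).trans hzh
    refine le_trans ?_ (natAbs_coeff_intPoly_le z i)
    change _ ≤ (P₁.coeff i).natAbs
    rw [hcoef, Int.natAbs_mul]
    exact Nat.le_mul_of_pos_left _ (Int.natAbs_pos.2 hc0)
  · intro h
    have := (dvd_sub_right (h.mul_left c)).1 k₁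
    rw [pow_succ] at this
    have h1 : (p : ℤ) ∣ 1 :=
      (mul_dvd_mul_iff_left (pow_ne_zero b hp'.ne_zero)).1 (by rwa [mul_one])
    exact hp'.not_dvd_one h1

end Construction

section Hensel

variable {p : ℕ} [Fact p.Prime]

theorem exists_root_norm_sub_le (F : ℤ_[p][X]) (x : ℤ_[p]) {a b : ℕ} (hab : 2 * b < a)
    (h₀ : ‖F.eval x‖ ≤ (p : ℝ) ^ (-(a : ℤ))) (h₁ : ‖(derivative F).eval x‖ = (p : ℝ) ^ (-(b : ℤ))) :
    ∃ z, F.eval z = 0 ∧ ‖z - x‖ ≤ (p : ℝ) ^ (-((a - b : ℕ) : ℤ)) ∧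
      ‖(derivative F).eval z‖ = (p : ℝ) ^ (-(b : ℤ)) := by
  have hp1 : (1 : ℝ) < p := by exact_mod_cast (Fact.out : p.Prime).one_lt
  have hp0 : (0 : ℝ) < p := by linarith
  have hlt : ‖aeval x F‖ < ‖aeval x (derivative F)‖ ^ 2 := by
    rw [coe_aeval_eq_eval, h₁, ← zpow_natCast, ← zpow_mul]
    refine h₀.trans_lt (zpow_lt_zpow_right₀ hp1 ?_)
    push_cast
    omega
  obtain ⟨z, hz, hzx, hz', -⟩ := hensels_lemma hlt
  rw [coe_aeval_eq_eval] at hz hzx hz'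
  refine ⟨z, hz, ?_, hz'.trans h₁⟩
  obtain ⟨k, hk⟩ := binomExpansion F x (z - x)
  rw [add_sub_cancel, hz] at hk
  rcases eq_or_ne (z - x) 0 with h | h
  · rw [h, norm_zero]
    positivity
  have hpos : 0 < ‖z - x‖ := norm_pos_iff.2 h
  have e : (derivative F).eval x * (z - x) = -(F.eval x) + -(k * (z - x) ^ 2) := by
    linear_combination -hk
  have h1 := PadicInt.nonarchimedean (-(F.eval x)) (-(k * (z - x) ^ 2))
  rw [← e, norm_neg, norm_neg, norm_mul, norm_mul, norm_pow] at h1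
  have h2 : ‖k‖ * ‖z - x‖ ^ 2 < ‖(derivative F).eval x‖ * ‖z - x‖ := by
    calc ‖k‖ * ‖z - x‖ ^ 2 ≤ 1 * ‖z - x‖ ^ 2 := by gcongr; exact PadicInt.norm_le_one k
      _ = ‖z - x‖ * ‖z - x‖ := by ring
      _ < _ := by gcongr
  have h3 : ‖(derivative F).eval x‖ * ‖z - x‖ ≤ (p : ℝ) ^ (-(a : ℤ)) := by
    rcases le_max_iff.1 h1 with h | h
    · exact h.trans h₀
    · exact absurd h h2.not_ge
  rw [h₁] at h3
  have h4 : (p : ℝ) ^ (-(a : ℤ)) = (p : ℝ) ^ (-(b : ℤ)) * (p : ℝ) ^ (-((a - b : ℕ) : ℤ)) := by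
    rw [← zpow_add₀ hp0.ne']
    congr 1
    omega
  rw [h4] at h3
  exact le_of_mul_le_mul_left h3 (by positivity)

theorem exists_root_norm_eq (F : ℤ_[p][X]) (h₀ : ‖F.eval 0‖ < 1)
    (h₁ : ‖(derivative F).eval 0‖ = 1) : ∃ t, F.eval t = 0 ∧ ‖t‖ = ‖F.eval 0‖ := by
  have hlt : ‖aeval (0 : ℤ_[p]) F‖ < ‖aeval (0 : ℤ_[p]) (derivative F)‖ ^ 2 := by
    rw [coe_aeval_eq_eval, h₁, one_pow]
    exact h₀
  obtain ⟨t, ht, htx, -, -⟩ := hensels_lemma hlt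
  rw [coe_aeval_eq_eval] at ht htx
  rw [sub_zero, h₁] at htx
  refine ⟨t, ht, ?_⟩
  obtain ⟨k, hk⟩ := binomExpansion F 0 t
  rw [zero_add, ht] at hk
  have e : -(F.eval 0) = t * ((derivative F).eval 0 + k * t) := by linear_combination hk
  have h1 : ‖k * t‖ < 1 := by
    rw [norm_mul]
    exact (mul_le_of_le_one_left (norm_nonneg _) (PadicInt.norm_le_one k)).trans_lt htx
  have h2 : ‖(derivative F).eval 0 + k * t‖ = 1 := by
    rw [PadicInt.norm_add_eq_max_of_ne (by rw [h₁]; exact h1.ne'), h₁, max_eq_left h1.le]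
  rw [← norm_neg (F.eval 0), e, norm_mul, h2, mul_one]

theorem exists_two_roots (F : ℤ_[p][X]) (x : ℤ_[p]) {a b : ℕ} (hb : 0 < b) (hab : 2 * b < a)
    (h₀ : ‖F.eval x‖ ≤ (p : ℝ) ^ (-(a : ℤ))) (h₁ : ‖(derivative F).eval x‖ = (p : ℝ) ^ (-(b : ℤ)))
    (h₂ : ‖(hasseDeriv 2 F).eval x‖ = 1) :
    ∃ z t, F.eval z = 0 ∧ F.eval (z + t) = 0 ∧ ‖z - x‖ ≤ (p : ℝ) ^ (-((a - b : ℕ) : ℤ)) ∧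
      ‖t‖ = (p : ℝ) ^ (-(b : ℤ)) := by
  have hp1 : (1 : ℝ) < p := by exact_mod_cast (Fact.out : p.Prime).one_lt
  obtain ⟨z, hz, hzx, hz'⟩ := exists_root_norm_sub_le F x hab h₀ h₁
  have hzx1 : ‖z - x‖ < 1 := by
    refine hzx.trans_lt (zpow_lt_one_of_neg₀ hp1 ?_)
    omega
  have hz2 : ‖(hasseDeriv 2 F).eval z‖ = 1 := by
    obtain ⟨k, hk⟩ := (hasseDeriv 2 F).evalSubFactor z x
    have e : (hasseDeriv 2 F).eval z = (hasseDeriv 2 F).eval x + k * (z - x) := by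
      linear_combination hk
    have h1 : ‖k * (z - x)‖ < 1 := by
      rw [norm_mul]
      exact (mul_le_of_le_one_left (norm_nonneg _) (PadicInt.norm_le_one k)).trans_lt hzx1
    rw [e, PadicInt.norm_add_eq_max_of_ne (by rw [h₂]; exact h1.ne'), h₂, max_eq_left h1.le]
  have e0 : (taylor z F).divX.eval 0 = (derivative F).eval z := by
    rw [← coeff_zero_eq_eval_zero, coeff_divX, zero_add, taylor_coeff_one]
  have e1 : (derivative (taylor z F).divX).eval 0 = (hasseDeriv 2 F).eval z := by
    rw [← coeff_zero_eq_eval_zero, coeff_derivative, coeff_divX, taylor_coeff]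
    simp
  obtain ⟨t, ht, htn⟩ := exists_root_norm_eq (taylor z F).divX
    (by rw [e0, hz']; exact zpow_lt_one_of_neg₀ hp1 (by omega)) (by rw [e1, hz2])
  refine ⟨z, t, hz, ?_, hzx, by rw [htn, e0, hz']⟩
  have h := congrArg (eval t) (divX_mul_X_add (taylor z F))
  rw [eval_add, eval_mul, ht, zero_mul, zero_add, eval_C, taylor_coeff_zero, hz, taylor_eval,
    add_comm] at h
  exact h.symm

theorem exists_two_roots_of_dvd (P : ℤ[X]) (x : ℕ) {a b : ℕ} (hb : 0 < b) (hab : 2 * b < a)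
    (h₀ : (p : ℤ) ^ a ∣ P.eval (x : ℤ)) (h₁ : (p : ℤ) ^ b ∣ (derivative P).eval (x : ℤ))
    (h₁' : ¬ (p : ℤ) ^ (b + 1) ∣ (derivative P).eval (x : ℤ))
    (h₂ : ¬ (p : ℤ) ∣ (hasseDeriv 2 P).eval (x : ℤ)) :
    ∃ z t : ℚ_[p], ‖z‖ ≤ 1 ∧ aeval z P = 0 ∧ aeval (z + t) P = 0 ∧
      ‖z - (x : ℚ_[p])‖ ≤ (p : ℝ) ^ (-((a - b : ℕ) : ℤ)) ∧ ‖t‖ = (p : ℝ) ^ (-(b : ℤ)) := by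
  set F : ℤ_[p][X] := P.map (Int.castRingHom ℤ_[p]) with hF
  have ev : ∀ f : ℤ[X], (f.map (Int.castRingHom ℤ_[p])).eval (x : ℤ_[p]) =
      ((f.eval (x : ℤ) : ℤ) : ℤ_[p]) := fun f => by
    rw [eval_natCast_map, eq_intCast]
  have hF2 : hasseDeriv 2 F = (hasseDeriv 2 P).map (Int.castRingHom ℤ_[p]) := by
    ext i
    simp [hF, hasseDeriv_coeff]
  have coe : ∀ w : ℤ_[p], F.eval w = 0 → aeval (w : ℚ_[p]) P = 0 := fun w hw => by
    rw [hF, eval_map, ← algebraMap_int_eq, ← aeval_def] at hw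
    have := aeval_algebraMap_apply ℚ_[p] w P
    rw [hw, map_zero] at this
    exact this
  obtain ⟨z, t, hz, hzt, hzx, ht⟩ := exists_two_roots F (x : ℤ_[p]) hb hab
    (by rw [hF, ev, PadicInt.norm_int_le_pow_iff_dvd]; exact_mod_cast h₀)
    (by
      rw [hF, derivative_map, ev]
      refine le_antisymm (PadicInt.norm_int_le_pow_iff_dvd.2 (by exact_mod_cast h₁)) ?_
      by_contra! hlt
      apply h₁'
      have h := (PadicInt.norm_lt_pow_iff_norm_le_pow_sub_one _ _).1 hlt
      have e : -(b : ℤ) - 1 = -((b + 1 : ℕ) : ℤ) := by push_cast; ring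
      rw [e] at h
      exact_mod_cast PadicInt.norm_int_le_pow_iff_dvd.1 h)
    (by
      rw [hF2, ev]
      refine le_antisymm (PadicInt.norm_le_one _) ?_
      by_contra! hlt
      exact h₂ ((PadicInt.norm_int_lt_one_iff_dvd _).1 hlt))
  refine ⟨z, t, PadicInt.norm_le_one z, coe z hz, ?_, ?_, ht⟩
  · rw [← PadicInt.coe_add]
    exact coe _ hzt
  · have : ‖((z - (x : ℤ_[p]) : ℤ_[p]) : ℚ_[p])‖ ≤ (p : ℝ) ^ (-((a - b : ℕ) : ℤ)) := hzx
    rwa [PadicInt.coe_sub, PadicInt.coe_natCast] at this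

end Hensel

section Counting

variable {p : ℕ} [Fact p.Prime]

theorem pow_mul_norm_aeval_le_one {P : ℤ[X]} {x j : ℕ} (h : (p : ℤ) ^ j ∣ P.eval (x : ℤ)) :
    (p : ℝ) ^ j * ‖aeval (x : ℚ_[p]) P‖ ≤ 1 := by
  have hp0 : (0 : ℝ) < p := by exact_mod_cast (Fact.out : p.Prime).pos
  have h2 : aeval (x : ℚ_[p]) P = ((P.eval (x : ℤ) : ℤ) : ℚ_[p]) := by
    have := aeval_algebraMap_apply ℚ_[p] (x : ℤ) P
    simpa using this
  have h3 := (Padic.norm_int_le_pow_iff_dvd (p := p) (P.eval (x : ℤ)) j).2 (by exact_mod_cast h)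
  rw [zpow_neg, zpow_natCast] at h3
  rw [h2, mul_comm]
  exact (le_inv_mul_iff₀' (pow_pos hp0 j)).1 (by simpa using h3)

theorem exists_poly_of_hasFlag {q : ℕ} (hq : q.Prime) (hpq : q ≠ p) {n : ℕ} (hn : 2 ≤ n)
    {a b N r J : ℕ} (hb : 0 < b) (hab : 2 * b < a) {Q σ : ℝ} (hQ : 0 < Q) {z : Fin (p ^ N)}
    (h : HasFlag (fun (V : Submodule ℚ (Fin (n + 1) → ℚ)) (z : Fin (p ^ N)) =>
      polySize p (n + 1) a b Q V z) {V | V ≠ ⊥} 1 σ z)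
    (hr : (n + 1) * (r : ℝ) ≤ σ * Q)
    (hJ : p ^ a * (p ^ (b + 1) * (p * (q ^ 2) ^ (n + 1))) < J * (r + 1) ^ (n + 1)) :
    ∃ w : ℚ_[p], ‖w‖ ≤ 1 ∧ ‖w - ((z : ℕ) : ℚ_[p])‖ ≤ (p : ℝ) ^ (-((a - b : ℕ) : ℤ)) ∧
      ∃ P : ℤ[X], Irreducible P ∧ P.natDegree = n ∧ aeval w P = 0 ∧ r < polyHeight P ∧
        polyHeight P ≤ J * (r + 1) ∧
        ∃ t : ℚ_[p], aeval (w + t) P = 0 ∧ ‖t‖ = (p : ℝ) ^ (-(b : ℤ)) := by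
  have hn1 : (0 : ℝ) < n + 1 := by positivity
  obtain ⟨P, hirr, hdeg, hlow, hup, h₀, h₁, h₁', h₂⟩ :=
    exists_irreducible_poly (a := a) (b := b) (x := ((z : ℕ) : ℤ)) Fact.out hq hpq hn
      (fun v hv0 hv hv' => by
        have := lt_vecHeight_of_hasFlag (fun (x : Fin (p ^ N)) y => norm_evalHom_le (x : ℕ) y)
          (fun x y => norm_derivHom_le (x : ℕ) y) hQ h hv0
          (by rw [evalHom_apply]; exact pow_mul_norm_aeval_le_one hv)
          (by rw [derivHom_apply]; exact pow_mul_norm_aeval_le_one hv')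
        have h2 := hr.trans_lt this
        push_cast at h2
        exact_mod_cast lt_of_mul_lt_mul_left h2 hn1.le) hJ
  obtain ⟨w, t, hw1, hw, hwt, hwz, ht⟩ := exists_two_roots_of_dvd P z hb hab h₀ h₁ h₁' h₂
  exact ⟨w, hw1, hwz, P, hirr, hdeg, hw, hlow, hup, t, hwt, ht⟩

open Classical in
theorem pow_le_two_mul_card_image {N M s : ℕ} (hMN : M ≤ N) (hsM : s ≤ M)
    (S : Finset (Fin (p ^ N))) (hS : ((p ^ (N - s) : ℕ) : ℝ) ≤ 2 * S.card)
    (f : Fin (p ^ N) → ℚ_[p])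
    (hf : ∀ z ∈ S, ‖f z - ((z : ℕ) : ℚ_[p])‖ ≤ (p : ℝ) ^ (-(M : ℤ))) :
    ((p ^ (M - s) : ℕ) : ℝ) ≤ 2 * (S.image f).card := by
  have hp := (Fact.out : p.Prime)
  have h : S.card ≤ p ^ (N - M) * (S.image f).card := by
    refine Finset.card_le_mul_card_image S _ fun y hy => ?_
    obtain ⟨z, hz, rfl⟩ := Finset.mem_image.1 hy
    rw [← card_resBall z M hp.pos hMN]
    refine Finset.card_le_card fun u hu => mem_resBall.2 (modEq_of_norm_sub_le ?_)
    obtain ⟨huS, huz⟩ := Finset.mem_filter.1 hu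
    have e : ((u : ℕ) : ℚ_[p]) - ((z : ℕ) : ℚ_[p]) =
        (f z - ((z : ℕ) : ℚ_[p])) - (f u - ((u : ℕ) : ℚ_[p])) := by
      rw [huz]
      ring
    rw [e]
    exact (norm_sub_le_max_padic _ _).trans (max_le (hf z hz) (hf u huS))
  have h2 : (p ^ (N - M) : ℕ) * p ^ (M - s) = p ^ (N - s) := by
    rw [← pow_add]
    congr 1
    omega
  have hpos : (0 : ℝ) < (p ^ (N - M) : ℕ) := by exact_mod_cast pow_pos hp.pos _
  refine le_of_mul_le_mul_left ?_ hpos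
  rw [← Nat.cast_mul, h2]
  refine hS.trans ?_
  have h' : (S.card : ℝ) ≤ (p ^ (N - M) : ℕ) * ((S.image f).card : ℝ) := by exact_mod_cast h
  linarith

theorem measure_closedBall_le (μ : Measure ℚ_[p]) [μ.IsAddHaarMeasure]
    (hμ : μ {x : ℚ_[p] | ‖x‖ ≤ 1} = 1) (x₀ : ℚ_[p]) (s : ℕ) :
    μ {x : ℚ_[p] | ‖x - x₀‖ ≤ (p : ℝ) ^ (-(s : ℤ))} ≤ ENNReal.ofReal ((p : ℝ) ^ (-(s : ℤ))) := by
  have hp := (Fact.out : p.Prime)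
  have hp1 : (1 : ℝ) < p := by exact_mod_cast hp.one_lt
  have hps : (0 : ℝ) < (p : ℝ) ^ s := by positivity
  set R : ℝ := (p : ℝ) ^ (-(s : ℤ)) with hR
  set D : ℚ_[p] → Set ℚ_[p] := fun y => {x | ‖x - y‖ ≤ R} with hD
  have htrans : ∀ y, μ (D y) = μ (D 0) := fun y => by
    have : D y = (fun x => x + -y) ⁻¹' D 0 := by
      ext x
      simp [hD, sub_eq_add_neg]
    rw [this, measure_preimage_add_right]
  have hmeas : ∀ y, MeasurableSet (D y) := fun y => by
    refine IsClosed.measurableSet ?_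
    exact isClosed_le (by fun_prop) continuous_const
  have hdisj : Set.PairwiseDisjoint (↑(Finset.range (p ^ s))) fun i : ℕ => D (i : ℚ_[p]) := by
    intro i hi j hj hij
    refine Set.disjoint_left.2 fun x hxi hxj => hij ?_
    have h : ‖(i : ℚ_[p]) - j‖ ≤ R := by
      have e : (i : ℚ_[p]) - j = (x - j) - (x - i) := by ring
      rw [e]
      exact (norm_sub_le_max_padic _ _).trans (max_le hxj hxi)
    exact (modEq_of_norm_sub_le h).eq_of_lt_of_lt (Finset.mem_range.1 hi) (Finset.mem_range.1 hj)
  have hsub : (⋃ i ∈ Finset.range (p ^ s), D (i : ℚ_[p])) ⊆ {x : ℚ_[p] | ‖x‖ ≤ 1} := by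
    intro x hx
    simp only [Set.mem_iUnion] at hx
    obtain ⟨i, -, hi⟩ := hx
    have hi' : ‖x - (i : ℚ_[p])‖ ≤ R := hi
    have hR1 : R ≤ 1 := zpow_le_one_of_nonpos₀ hp1.le (by omega)
    have h := Padic.nonarchimedean (x - (i : ℚ_[p])) i
    rw [sub_add_cancel] at h
    exact h.trans (max_le (hi'.trans hR1) (by exact_mod_cast Padic.norm_int_le_one (i : ℤ)))
  have hle := measure_mono (μ := μ) hsub
  rw [hμ, measure_biUnion_finset hdisj fun i _ => hmeas _,
    Finset.sum_congr rfl fun i _ => htrans _, Finset.sum_const, Finset.card_range,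
    nsmul_eq_mul] at hle
  change μ (D x₀) ≤ _
  rw [htrans, hR, zpow_neg, zpow_natCast, ENNReal.ofReal_inv_of_pos hps,
    ENNReal.ofReal_pow (by linarith), ENNReal.ofReal_natCast]
  rw [ENNReal.le_inv_iff_mul_le, mul_comm]
  exact_mod_cast hle

theorem finite_setOf_root_of_polyHeight_le (p : ℕ) [Fact p.Prime] (n H : ℕ) :
    {w : ℚ_[p] | ∃ P : ℤ[X], P ≠ 0 ∧ P.natDegree = n ∧ polyHeight P ≤ H ∧
      aeval w P = 0}.Finite := by
  have hfin : (intPoly (n + 1) '' Set.Icc (fun _ => -(H : ℤ)) fun _ => (H : ℤ)).Finite :=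
    (Set.finite_Icc _ _).image _
  refine (hfin.biUnion fun P _ => rootSet_finite P ℚ_[p]).subset ?_
  rintro w ⟨P, hP0, hdeg, hH, hw⟩
  obtain ⟨v, hv, hvh⟩ := exists_intPoly_eq (show P.natDegree < n + 1 by omega)
  have h : ∀ i, (v i).natAbs ≤ H := fun i => (natAbs_le_vecHeight v i).trans (hvh.trans hH)
  have hl : ∀ i, -(H : ℤ) ≤ v i := fun i => by have := h i; omega
  have hu : ∀ i, v i ≤ (H : ℤ) := fun i => by have := h i; omega
  exact Set.mem_biUnion (x := P) ⟨v, ⟨hl, hu⟩, hv⟩ (mem_rootSet.2 ⟨hP0, hw⟩)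

end Counting

section Assembly

variable {p : ℕ} [Fact p.Prime]

theorem exists_pow_near_rpow {y : ℝ} (hy : 1 < y) {Q θ e : ℝ} (hQ : 1 ≤ Q) (hθ : 0 ≤ θ)
    (hθe : θ ≤ e) : ∃ b M : ℕ, 0 < b ∧ b < M ∧ Q ^ θ ≤ y ^ b ∧ y ^ b ≤ y * Q ^ θ ∧
      y * Q ^ e ≤ y ^ M ∧ y ^ M ≤ y ^ 2 * Q ^ e := by
  have hy0 : 0 < y := by linarith
  obtain ⟨k, hk, hk'⟩ := exists_nat_pow_near (Real.one_le_rpow hQ hθ) hy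
  obtain ⟨l, hl, hl'⟩ := exists_nat_pow_near (Real.one_le_rpow hQ (hθ.trans hθe)) hy
  have hkl : k < l + 1 := by
    rw [← pow_lt_pow_iff_right₀ hy]
    exact (hk.trans (Real.rpow_le_rpow_of_exponent_le hQ hθe)).trans_lt hl'
  refine ⟨k + 1, l + 2, by omega, by omega, hk'.le, ?_, ?_, ?_⟩
  · rw [pow_succ']
    gcongr
  · rw [show l + 2 = (l + 1) + 1 by omega, pow_succ']
    gcongr
  · rw [show l + 2 = 2 + l by omega, pow_add]
    gcongr

theorem exists_finset_roots (p : ℕ) [Fact p.Prime] (n : ℕ) (hn : 2 ≤ n) :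
    ∃ C₁ C₂ : ℝ, 0 < C₁ ∧ 0 < C₂ ∧ ∀ θ : ℝ, 0 ≤ θ → θ ≤ ((n : ℝ) + 1) / 3 →
      ∀ x₀ s : ℕ, x₀ < p ^ s → ∃ Q₀ : ℝ, 1 ≤ Q₀ ∧ ∀ Q : ℝ, Q₀ ≤ Q →
        ∃ S : Finset ℚ_[p], p * Q ^ ((n : ℝ) + 1 - 2 * θ) ≤ 2 * p ^ s * S.card ∧
          ∀ w ∈ S, ‖w‖ ≤ 1 ∧ ‖w - (x₀ : ℚ_[p])‖ ≤ (p : ℝ) ^ (-(s : ℤ)) ∧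
            ∃ P : ℤ[X], Irreducible P ∧ P.natDegree = n ∧ aeval w P = 0 ∧
              C₁ * Q ≤ polyHeight P ∧ polyHeight P ≤ C₂ * Q ∧
              ∃ t : ℚ_[p], t ≠ 0 ∧ aeval (w + t) P = 0 ∧ ‖t‖ ≤ Q ^ (-θ) := by
  classical
  have hp := (Fact.out : p.Prime)
  have hp1 : (1 : ℝ) < p := by exact_mod_cast hp.one_lt
  have hp0 : (0 : ℝ) < p := by linarith
  obtain ⟨l, σ, hσ, -, hflag⟩ := exists_half_le_card_hasFlag p (n + 1) (by omega)
  obtain ⟨q, hq, hqp⟩ : ∃ q : ℕ, q.Prime ∧ q ≠ p := by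
    obtain ⟨q, hqp, hq⟩ := Nat.exists_infinite_primes (p + 1)
    exact ⟨q, hq, by omega⟩
  set ε : ℝ := σ / (n + 1) with hε
  have hn1 : (0 : ℝ) < n + 1 := by positivity
  have hε0 : 0 < ε := by positivity
  obtain ⟨J, hJ⟩ := exists_nat_gt ((p : ℝ) ^ 6 * ((q : ℝ) ^ 2) ^ (n + 1) / ε ^ (n + 1))
  refine ⟨ε, J * (ε + 1) + 1, hε0, by positivity, fun θ hθ hθn x₀ s hx₀ => ?_⟩
  obtain ⟨c, hc, hflag⟩ := hflag x₀ s hx₀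
  refine ⟨max (p ^ s) (max 1 (2 / c)), le_max_of_le_right (le_max_left _ _), fun Q hQQ => ?_⟩
  have hQs : (p : ℝ) ^ s ≤ Q := (le_max_left _ _).trans hQQ
  have hQ1 : 1 ≤ Q := ((le_max_left _ _).trans (le_max_right _ _)).trans hQQ
  have hQc : 2 / c ≤ Q := ((le_max_right _ _).trans (le_max_right _ _)).trans hQQ
  have hQ0 : 0 < Q := by linarith
  have hQc' : 1 < Q * c := by
    rw [div_le_iff₀ hc] at hQc
    linarith
  have hn2 : (2 : ℝ) ≤ n := by exact_mod_cast hn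
  obtain ⟨b, M, hb, hbM, hb1, hb2, hM1, hM2⟩ := exists_pow_near_rpow hp1 hQ1 hθ
    (show θ ≤ (n : ℝ) + 1 - 2 * θ by linarith)
  set a := M + b with ha
  have hMp : Q ^ ((n : ℝ) + 1 - 2 * θ) ≤ (p : ℝ) ^ M :=
    (le_mul_of_one_le_left (by positivity) hp1.le).trans hM1
  have hsM : s ≤ M := by
    rw [← pow_le_pow_iff_right₀ hp1]
    refine (hQs.trans ?_).trans hMp
    conv_lhs => rw [← Real.rpow_one Q]
    exact Real.rpow_le_rpow_of_exponent_le hQ1 (by linarith)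
  have hQn : Q ^ ((n : ℝ) + 1 - 2 * θ) * (Q ^ θ) ^ 2 = Q ^ (n + 1) := by
    rw [← Real.rpow_natCast (Q ^ θ), ← Real.rpow_mul hQ0.le, ← Real.rpow_add hQ0,
      ← Real.rpow_natCast Q]
    congr 1
    push_cast
    ring
  have hpab : (p : ℝ) ^ (a + b) = p ^ M * (p ^ b) ^ 2 := by
    rw [ha]
    ring
  have hab1 : Q ^ (n + 1) < (p : ℝ) ^ (a + b) := by
    rw [hpab, ← hQn]
    have h0 : 0 < Q ^ ((n : ℝ) + 1 - 2 * θ) := by positivity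
    have h1 : 0 < Q ^ θ := by positivity
    have h2 : (Q ^ θ) ^ 2 ≤ ((p : ℝ) ^ b) ^ 2 := by gcongr
    have h3 : Q ^ ((n : ℝ) + 1 - 2 * θ) < (p : ℝ) ^ M :=
      (lt_mul_of_one_lt_left h0 hp1).trans_le hM1
    exact mul_lt_mul h3 h2 (by positivity) (by positivity)
  have hab2 : (p : ℝ) ^ (a + b) ≤ p ^ 4 * Q ^ (n + 1) := by
    rw [hpab, ← hQn]
    calc (p : ℝ) ^ M * (p ^ b) ^ 2 ≤ (p ^ 2 * Q ^ ((n : ℝ) + 1 - 2 * θ)) * (p * Q ^ θ) ^ 2 := by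
          gcongr
      _ = _ := by ring
  have hQa : Q < (p : ℝ) ^ a * c := by
    have h1 : Q ^ 2 ≤ (p : ℝ) ^ a := by
      rw [ha, pow_add]
      calc Q ^ 2 = Q ^ (2 : ℝ) := by norm_cast
        _ ≤ Q ^ ((n : ℝ) + 1 - 2 * θ + θ) :=
          Real.rpow_le_rpow_of_exponent_le hQ1 (by linarith)
        _ = Q ^ ((n : ℝ) + 1 - 2 * θ) * Q ^ θ := Real.rpow_add hQ0 _ _
        _ ≤ _ := by gcongr
    calc Q < Q * (Q * c) := lt_mul_of_one_lt_right hQ0 hQc'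
      _ = Q ^ 2 * c := by ring
      _ ≤ _ := by gcongr
  have hQab : Q ^ (n + 1 - 1) < (p : ℝ) ^ (a + b) * c := by
    rw [Nat.add_sub_cancel]
    calc Q ^ n < Q ^ n * (Q * c) := lt_mul_of_one_lt_right (by positivity) hQc'
      _ = Q ^ (n + 1) * c := by ring
      _ ≤ _ := by gcongr
  obtain ⟨N₁, hN₁⟩ := pow_unbounded_of_one_lt (2 * (n + 1) + 1) hp.one_lt
  set N := a + b + l + s + N₁ with hN
  have hcard := hflag a b N Q hQ1 hQa hQab hab1 (by omega) (by omega) (by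
    refine (Nat.mul_le_mul_right _ hN₁.le).trans ?_
    rw [← pow_add]
    exact Nat.pow_le_pow_right hp.pos (by omega))
  set G := Finset.univ.filter fun z : Fin (p ^ N) => (z : ℕ) ≡ x₀ [MOD p ^ s] ∧
    HasFlag (fun (V : Submodule ℚ (Fin (n + 1) → ℚ)) (z : Fin (p ^ N)) =>
      polySize p (n + 1) a b Q V z) {V | V ≠ ⊥} 1 σ z with hG
  set r := ⌊ε * Q⌋₊ with hr
  have hr1 : (r : ℝ) ≤ ε * Q := Nat.floor_le (by positivity)
  have hr2 : ε * Q < r + 1 := Nat.lt_floor_add_one _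
  have hJ' : p ^ a * (p ^ (b + 1) * (p * (q ^ 2) ^ (n + 1))) < J * (r + 1) ^ (n + 1) := by
    have hq0 : (0 : ℝ) < q := by exact_mod_cast hq.pos
    rw [div_lt_iff₀ (by positivity)] at hJ
    have : (p : ℝ) ^ a * (p ^ (b + 1) * (p * (q ^ 2) ^ (n + 1))) < J * (r + 1) ^ (n + 1) := by
      calc (p : ℝ) ^ a * (p ^ (b + 1) * (p * (q ^ 2) ^ (n + 1))) =
            p ^ (a + b) * (p ^ 2 * (q ^ 2) ^ (n + 1)) := by ring
        _ ≤ p ^ 4 * Q ^ (n + 1) * (p ^ 2 * (q ^ 2) ^ (n + 1)) := by gcongr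
        _ = p ^ 6 * (q ^ 2) ^ (n + 1) * Q ^ (n + 1) := by ring
        _ < J * ε ^ (n + 1) * Q ^ (n + 1) := by gcongr
        _ = J * (ε * Q) ^ (n + 1) := by ring
        _ ≤ _ := by gcongr
    exact_mod_cast this
  have hroot : ∀ z : Fin (p ^ N), ∃ w : ℚ_[p], z ∈ G → (‖w‖ ≤ 1 ∧
      ‖w - ((z : ℕ) : ℚ_[p])‖ ≤ (p : ℝ) ^ (-(M : ℤ)) ∧
      ∃ P : ℤ[X], Irreducible P ∧ P.natDegree = n ∧ aeval w P = 0 ∧ r < polyHeight P ∧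
        polyHeight P ≤ J * (r + 1) ∧
        ∃ t : ℚ_[p], aeval (w + t) P = 0 ∧ ‖t‖ = (p : ℝ) ^ (-(b : ℤ))) := fun z => by
    by_cases hz : z ∈ G
    · obtain ⟨w, hw⟩ := exists_poly_of_hasFlag hq hqp hn hb (show 2 * b < a by omega) hQ0
        (Finset.mem_filter.1 hz).2.2 (by
          refine (mul_le_mul_of_nonneg_left hr1 hn1.le).trans (le_of_eq ?_)
          rw [hε]
          field_simp) hJ'
      rw [show a - b = M by omega] at hw
      exact ⟨w, fun _ => hw⟩
    · exact ⟨0, fun h => absurd h hz⟩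
  choose f hf using hroot
  have himage := pow_le_two_mul_card_image (show M ≤ N by omega) hsM G hcard f
    fun z hz => (hf z hz).2.1
  refine ⟨G.image f, ?_, ?_⟩
  · have e : (p : ℝ) ^ M = p ^ s * ((p ^ (M - s) : ℕ) : ℝ) := by
      push_cast
      rw [← pow_add]
      congr 1
      omega
    refine hM1.trans ?_
    rw [e, mul_comm 2, mul_assoc]
    gcongr
  · intro w hw
    obtain ⟨z, hz, rfl⟩ := Finset.mem_image.1 hw
    obtain ⟨hw1, hwz, P, hirr, hdeg, hP, hlow, hup, t, ht, htb⟩ := hf z hz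
    have hzx := norm_natCast_sub_le (p := p) (Finset.mem_filter.1 hz).2.1
    have hpow : (p : ℝ) ^ (-(M : ℤ)) ≤ (p : ℝ) ^ (-(s : ℤ)) :=
      zpow_le_zpow_right₀ hp1.le (by omega)
    refine ⟨hw1, ?_, P, hirr, hdeg, hP, ?_, ?_, t, ?_, ht, ?_⟩
    · rw [← sub_add_sub_cancel (f z) ((z : ℕ) : ℚ_[p])]
      exact (Padic.nonarchimedean _ _).trans (max_le (hwz.trans hpow) hzx)
    · have : ((r + 1 : ℕ) : ℝ) ≤ polyHeight P := by exact_mod_cast hlow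
      push_cast at this
      linarith
    · have h1 : (polyHeight P : ℝ) ≤ J * (r + 1) := by exact_mod_cast hup
      have h2 : (J : ℝ) * (r + 1) ≤ J * (ε * Q + Q) := by gcongr
      nlinarith
    · rw [← norm_pos_iff, htb]
      positivity
    · rw [htb, Real.rpow_neg hQ0.le, zpow_neg, zpow_natCast]
      gcongr

end Assembly

/-- Let `n ≥ 2`, `p` a prime and `0 < κ < 1`. There are constants
`C₀, C₁, C₂ > 0` (depending only on `n, p, κ`) such that for every `0 ≤ θ ≤ (n+1)/3` and
every ball `B ⊆ ℤ_p`, for all sufficiently large `Q`,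
`#(𝔸_n(Q, θ, C₀, C₁, C₂) ∩ B) ≥ (κ/(p C₀)) Q^{n+1−2θ} μ(B)`, where `𝔸_n(Q, θ, C₀, C₁, C₂)`
is the set of `α ∈ ℤ_p` which are roots of an irreducible `P ∈ ℤ[X]` of degree `n` with
`C₁ Q ≤ H(P) ≤ C₂ Q` having a root `β` in the algebraic closure of `ℚ_p` with
`0 < |α − β|_p ≤ C₀ Q^{−θ}`.

Here `μ` is the Haar measure on `ℚ_p` normalized so that `μ(ℤ_p) = 1`, and the algebraic
closure of `ℚ_p` with its (unique) extension of the `p`-adic absolute value is modelled by an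
algebraically closed normed field `L`, algebraic over `ℚ_p`, whose norm restricts to the
`p`-adic norm on `ℚ_p`. -/
theorem stmt2 (p : ℕ) [Fact p.Prime] (n : ℕ) (hn : 2 ≤ n)
    (κ : ℝ) (hκ0 : 0 < κ) (hκ1 : κ < 1)
    (L : Type*) [NormedField L] [Algebra ℚ_[p] L] [IsAlgClosed L]
    [Algebra.IsAlgebraic ℚ_[p] L]
    (hL : ∀ y : ℚ_[p], ‖algebraMap ℚ_[p] L y‖ = ‖y‖)
    (μ : Measure ℚ_[p]) [μ.IsAddHaarMeasure]
    (hμ : μ {x : ℚ_[p] | ‖x‖ ≤ 1} = 1) :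
    ∃ C₀ C₁ C₂ : ℝ, 0 < C₀ ∧ 0 < C₁ ∧ 0 < C₂ ∧
      ∀ θ : ℝ, 0 ≤ θ → θ ≤ ((n : ℝ) + 1) / 3 →
      ∀ (x₀ : ℤ_[p]) (r : ℝ), 0 < r → r ≤ 1 →
      ∃ Q₀ : ℝ, ∀ Q : ℝ, Q₀ ≤ Q →
        ENNReal.ofReal (κ / (p * C₀) * Q ^ ((n : ℝ) + 1 - 2 * θ)) *
            μ {x : ℚ_[p] | ‖x - (x₀ : ℚ_[p])‖ ≤ r} ≤
          (({α : ℚ_[p] | ‖α‖ ≤ 1 ∧ ∃ P : Polynomial ℤ,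
                Irreducible P ∧ P.natDegree = n ∧ Polynomial.aeval α P = 0 ∧
                C₁ * Q ≤ (polyHeight P : ℝ) ∧ (polyHeight P : ℝ) ≤ C₂ * Q ∧
                ∃ β : L, Polynomial.aeval β P = 0 ∧ β ≠ algebraMap ℚ_[p] L α ∧
                  ‖algebraMap ℚ_[p] L α - β‖ ≤ C₀ * Q ^ (-θ)} ∩
              {x : ℚ_[p] | ‖x - (x₀ : ℚ_[p])‖ ≤ r}).ncard : ENNReal) := by
  classical
  have hp1 : (1 : ℝ) < p := by exact_mod_cast (Fact.out : p.Prime).one_lt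
  have hp2 : (2 : ℝ) ≤ p := by exact_mod_cast (Fact.out : p.Prime).two_le
  have hp0 : (0 : ℝ) < p := by linarith
  obtain ⟨C₁, C₂, hC₁, hC₂, hmain⟩ := exists_finset_roots p n hn
  refine ⟨1, C₁, C₂, one_pos, hC₁, hC₂, fun θ hθ hθn x₀ r hr hr1 => ?_⟩
  obtain ⟨k, hk, hk'⟩ := exists_nat_pow_near_of_lt_one hr hr1 (inv_pos.2 hp0)
    (inv_lt_one_of_one_lt₀ hp1)
  obtain ⟨Q₀, hQ₀, hQ⟩ := hmain θ hθ hθn (x₀.appr (k + 1)) (k + 1) (x₀.appr_lt _)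
  refine ⟨Q₀, fun Q hQQ => ?_⟩
  have hQ0 : 0 < Q := by linarith
  obtain ⟨S, hS, hSr⟩ := hQ Q hQQ
  have hx₀ : ‖(x₀ : ℚ_[p]) - (x₀.appr (k + 1) : ℕ)‖ ≤ (p : ℝ) ^ (-((k + 1 : ℕ) : ℤ)) := by
    have h := (PadicInt.norm_le_pow_iff_mem_span_pow _ _).2 (x₀.appr_spec (k + 1))
    rwa [PadicInt.norm_def, PadicInt.coe_sub, PadicInt.coe_natCast] at h
  set T : Set ℚ_[p] := {α : ℚ_[p] | ‖α‖ ≤ 1 ∧ ∃ P : Polynomial ℤ,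
    Irreducible P ∧ P.natDegree = n ∧ Polynomial.aeval α P = 0 ∧
    C₁ * Q ≤ (polyHeight P : ℝ) ∧ (polyHeight P : ℝ) ≤ C₂ * Q ∧
    ∃ β : L, Polynomial.aeval β P = 0 ∧ β ≠ algebraMap ℚ_[p] L α ∧
      ‖algebraMap ℚ_[p] L α - β‖ ≤ 1 * Q ^ (-θ)} ∩
    {x : ℚ_[p] | ‖x - (x₀ : ℚ_[p])‖ ≤ r} with hT
  have hTfin : T.Finite := by
    refine (finite_setOf_root_of_polyHeight_le p n ⌊C₂ * Q⌋₊).subset ?_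
    rintro w ⟨⟨-, P, hirr, hdeg, hw, -, hup, -⟩, -⟩
    exact ⟨P, hirr.ne_zero, hdeg, Nat.le_floor hup, hw⟩
  have hST : (S : Set ℚ_[p]) ⊆ T := by
    intro w hw
    obtain ⟨hw1, hwx, P, hirr, hdeg, hP, hlow, hup, t, ht0, ht, htQ⟩ := hSr w hw
    refine ⟨⟨hw1, P, hirr, hdeg, hP, hlow, hup, algebraMap ℚ_[p] L (w + t), ?_, ?_, ?_⟩, ?_⟩
    · rw [aeval_algebraMap_apply, ht, map_zero]
    · rw [map_add]
      intro h
      exact ht0 ((map_eq_zero (algebraMap ℚ_[p] L)).1 (by simpa using h))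
    · rw [← map_sub, hL, sub_add_cancel_left, norm_neg, one_mul]
      exact htQ
    · have e : w - (x₀ : ℚ_[p]) = (w - (x₀.appr (k + 1) : ℕ)) -
          ((x₀ : ℚ_[p]) - (x₀.appr (k + 1) : ℕ)) := by ring
      change ‖w - (x₀ : ℚ_[p])‖ ≤ r
      rw [e]
      refine (norm_sub_le_max_padic _ _).trans ((max_le hwx hx₀).trans ?_)
      rw [zpow_neg, zpow_natCast, ← inv_pow]
      exact hk.le
  have hcard : (S.card : ℝ) ≤ T.ncard := by
    rw [← Set.ncard_coe_finset]
    exact_mod_cast Set.ncard_le_ncard hST hTfin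
  have hball : μ {x : ℚ_[p] | ‖x - (x₀ : ℚ_[p])‖ ≤ r} ≤ ENNReal.ofReal ((p : ℝ) ^ (-(k : ℤ))) := by
    refine (measure_mono fun x hx => ?_).trans (measure_closedBall_le μ hμ (x₀ : ℚ_[p]) k)
    have hx' : ‖x - (x₀ : ℚ_[p])‖ ≤ r := hx
    refine hx'.trans ?_
    rw [zpow_neg, zpow_natCast, ← inv_pow]
    exact hk'
  have hreal : κ / (p * 1) * Q ^ ((n : ℝ) + 1 - 2 * θ) * (p : ℝ) ^ (-(k : ℤ)) ≤ T.ncard := by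
    refine le_trans ?_ hcard
    have hy : 0 < Q ^ ((n : ℝ) + 1 - 2 * θ) := by positivity
    have hpk : (0 : ℝ) < (p : ℝ) ^ k := by positivity
    have hκp : κ / p ≤ 1 / 2 := by
      gcongr
    rw [mul_one, zpow_neg, zpow_natCast, ← div_eq_mul_inv, div_le_iff₀ hpk]
    have h1 : Q ^ ((n : ℝ) + 1 - 2 * θ) ≤ 2 * p ^ k * S.card := by
      refine le_of_mul_le_mul_left (hS.trans (le_of_eq ?_)) hp0
      ring
    have h2 : κ / p * Q ^ ((n : ℝ) + 1 - 2 * θ) ≤ 1 / 2 * Q ^ ((n : ℝ) + 1 - 2 * θ) := by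
      gcongr
    linarith
  calc ENNReal.ofReal (κ / (p * 1) * Q ^ ((n : ℝ) + 1 - 2 * θ)) *
        μ {x : ℚ_[p] | ‖x - (x₀ : ℚ_[p])‖ ≤ r}
      ≤ ENNReal.ofReal (κ / (p * 1) * Q ^ ((n : ℝ) + 1 - 2 * θ)) *
        ENNReal.ofReal ((p : ℝ) ^ (-(k : ℤ))) := by gcongr
    _ = ENNReal.ofReal (κ / (p * 1) * Q ^ ((n : ℝ) + 1 - 2 * θ) * (p : ℝ) ^ (-(k : ℤ))) :=
        (ENNReal.ofReal_mul (by positivity)).symm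
    _ ≤ ENNReal.ofReal T.ncard := ENNReal.ofReal_le_ofReal hreal
    _ = T.ncard := ENNReal.ofReal_natCast _
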